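/- Let n be a positive integer and let B be an n×n integer matrix that is sign-skew-symmetric and acyclic. Then B is totally sign-skew-symmetric: for every finite sequence of indices k₁, …, k_s, the matrix μ_{k_s}(μ_{k_{s-1}}(⋯μ_{k_1}(B)⋯)) obtained by iterated matrix mutation is again sign-skew-symmetric. -/

import Mathlib

/-- An `n × n` integer matrix is sign-skew-symmetric if for all `i, j` either
`B i j = 0 = B j i` or `B i j * B j i < 0`. -/
def SignSkewSymm {n : ℕ} (B : Matrix (Fin n) (Fin n) ℤ) : Prop :=
  ∀ i j, (B i j = 0 ∧ B j i = 0) ∨ B i j * B j i < 0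

/-- Matrix mutation in direction `k`. -/
def matMut {n : ℕ} (k : Fin n) (B : Matrix (Fin n) (Fin n) ℤ) : Matrix (Fin n) (Fin n) ℤ :=
  fun i j =>
    if i = k ∨ j = k then - B i j
    else B i j + (|B i k| * B k j + B i k * |B k j|) / 2

/-- `B` is acyclic: the directed graph with an arrow `i → j` whenever `B i j > 0`
has no directed cycles. -/
def MatAcyclic {n : ℕ} (B : Matrix (Fin n) (Fin n) ℤ) : Prop :=
  ∀ i, ¬ Relation.TransGen (fun i j => 0 < B i j) i i


namespace SK
open Module

/-! ### representations -/

structure Rep {V : Type} (N : V → V → ℕ) where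
  X : V → Type
  [ac : ∀ v, AddCommGroup (X v)]
  [md : ∀ v, Module ℚ (X v)]
  [fd : ∀ v, FiniteDimensional ℚ (X v)]
  f : ∀ v w, Fin (N v w) → X v →ₗ[ℚ] X w
  S : Finset V
  hS : ∀ v, v ∉ S → Subsingleton (X v)

attribute [instance] Rep.ac Rep.md Rep.fd

variable {V : Type} {N : V → V → ℕ}

abbrev C0 (X Y : Rep N) := ∀ v, X.X v →ₗ[ℚ] Y.X v
abbrev C1 (X Y : Rep N) := ∀ v w, Fin (N v w) → (X.X v →ₗ[ℚ] Y.X w)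

def d (X Y : Rep N) : C0 X Y →ₗ[ℚ] C1 X Y where
  toFun h := fun v w a => Y.f v w a ∘ₗ h v - h w ∘ₗ X.f v w a
  map_add' := by
    intro g h; funext v w a; ext x; simp; abel
  map_smul' := by
    intro c h; funext v w a; ext x; simp [smul_sub]

theorem d_apply (X Y : Rep N) (h : C0 X Y) (v w : V) (a : Fin (N v w)) (x : X.X v) :
    d X Y h v w a x = Y.f v w a (h v x) - h w (X.f v w a x) := rfl

def HomZ (X Y : Rep N) : Prop := Function.Injective (d X Y)
def ExtZ (X Y : Rep N) : Prop := Function.Surjective (d X Y)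

theorem HomZ_iff (X Y : Rep N) : HomZ X Y ↔ ∀ h, d X Y h = 0 → h = 0 :=
  injective_iff_map_eq_zero _

noncomputable def dim (X : Rep N) : V →₀ ℤ :=
  Finsupp.onFinset X.S (fun v => (finrank ℚ (X.X v) : ℤ)) (by
    intro v hv
    by_contra h
    have := X.hS v h
    exact hv (by simp [finrank_zero_of_subsingleton]))

theorem dim_apply (X : Rep N) (v : V) : dim X v = finrank ℚ (X.X v) := rfl

theorem is_hom_apply {X Y : Rep N} {h : C0 X Y} (hh : d X Y h = 0) (v w : V) (a : Fin (N v w))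
    (x : X.X v) : Y.f v w a (h v x) = h w (X.f v w a x) := by
  have := d_apply X Y h v w a x
  rw [hh] at this
  exact sub_eq_zero.1 this.symm

theorem is_hom_of {X Y : Rep N} {h : C0 X Y}
    (hh : ∀ v w a x, Y.f v w a (h v x) = h w (X.f v w a x)) : d X Y h = 0 := by
  funext v w a; ext x
  rw [d_apply, hh]; simp

/-! composition -/
def c0 {X Y Z : Rep N} (g : C0 Y Z) (h : C0 X Y) : C0 X Z := fun v => g v ∘ₗ h v

theorem d_comp {X Y Z : Rep N} (g : C0 Y Z) (h : C0 X Y) (v w a) (x : X.X v) :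
    d X Z (c0 g h) v w a x = d Y Z g v w a (h v x) + g w (d X Y h v w a x) := by
  simp [d_apply, c0]

theorem comp_hom {X Y Z : Rep N} {g : C0 Y Z} {h : C0 X Y} (hg : d Y Z g = 0) (hh : d X Y h = 0) :
    d X Z (c0 g h) = 0 := by
  funext v w a; ext x
  rw [d_comp, hg, hh]; simp

def SES (A B C : Rep N) : Prop := ∃ i : C0 A B, ∃ p : C0 B C, d A B i = 0 ∧ d B C p = 0 ∧
  (∀ v, Function.Injective (i v)) ∧ (∀ v, Function.Surjective (p v)) ∧
  ∀ v, Function.Exact (i v) (p v)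

/-! two-term complexes -/
def SE2 {A0 A1 B0 B1 D0 D1 : Type} [AddCommGroup A0] [AddCommGroup A1] [AddCommGroup B0]
    [AddCommGroup B1] [AddCommGroup D0] [AddCommGroup D1]
    [Module ℚ A0] [Module ℚ A1] [Module ℚ B0] [Module ℚ B1] [Module ℚ D0] [Module ℚ D1]
    (dA : A0 →ₗ[ℚ] A1) (dB : B0 →ₗ[ℚ] B1) (dD : D0 →ₗ[ℚ] D1) : Prop :=
  ∃ (i0 : A0 →ₗ[ℚ] B0) (p0 : B0 →ₗ[ℚ] D0) (i1 : A1 →ₗ[ℚ] B1) (p1 : B1 →ₗ[ℚ] D1),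
    (∀ x, dB (i0 x) = i1 (dA x)) ∧ (∀ x, dD (p0 x) = p1 (dB x)) ∧
    Function.Injective i0 ∧ Function.Surjective p0 ∧ Function.Exact i0 p0 ∧
    Function.Injective i1 ∧ Function.Surjective p1 ∧ Function.Exact i1 p1

section
variable {A0 A1 B0 B1 D0 D1 : Type} [AddCommGroup A0] [AddCommGroup A1] [AddCommGroup B0]
    [AddCommGroup B1] [AddCommGroup D0] [AddCommGroup D1]
    [Module ℚ A0] [Module ℚ A1] [Module ℚ B0] [Module ℚ B1] [Module ℚ D0] [Module ℚ D1]
    {dA : A0 →ₗ[ℚ] A1} {dB : B0 →ₗ[ℚ] B1} {dD : D0 →ₗ[ℚ] D1}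

open Function

theorem SE2.injB (h : SE2 dA dB dD) (hA : Injective dA) (hD : Injective dD) : Injective dB := by
  obtain ⟨i0, p0, i1, p1, c1, c2, ii0, sp0, e0, ii1, sp1, e1⟩ := h
  rw [injective_iff_map_eq_zero] at *
  intro x hx
  have : p0 x = 0 := hD _ (by rw [c2, hx, map_zero])
  obtain ⟨y, rfl⟩ := (e0 x).1 this
  rw [c1] at hx
  rw [hA _ (ii1 _ hx), map_zero]

theorem SE2.injA (h : SE2 dA dB dD) (hB : Injective dB) : Injective dA := by
  obtain ⟨i0, p0, i1, p1, c1, c2, ii0, sp0, e0, ii1, sp1, e1⟩ := h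
  rw [injective_iff_map_eq_zero] at *
  intro x hx
  exact ii0 _ (hB _ (by rw [c1, hx, map_zero]))

theorem SE2.surjB (h : SE2 dA dB dD) (hA : Surjective dA) (hD : Surjective dD) :
    Surjective dB := by
  obtain ⟨i0, p0, i1, p1, c1, c2, ii0, sp0, e0, ii1, sp1, e1⟩ := h
  intro c
  obtain ⟨x, hx⟩ := hD (p1 c)
  obtain ⟨y, rfl⟩ := sp0 x
  obtain ⟨z, hz⟩ := (e1 (c - dB y)).1 (by rw [map_sub, ← c2, hx, sub_self])
  obtain ⟨w, rfl⟩ := hA z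
  exact ⟨y + i0 w, by rw [map_add, c1, hz]; abel⟩

theorem SE2.surjD (h : SE2 dA dB dD) (hB : Surjective dB) : Surjective dD := by
  obtain ⟨i0, p0, i1, p1, c1, c2, ii0, sp0, e0, ii1, sp1, e1⟩ := h
  intro c
  obtain ⟨x, rfl⟩ := sp1 c
  obtain ⟨y, rfl⟩ := hB x
  exact ⟨p0 y, c2 y⟩

theorem SE2.injD (h : SE2 dA dB dD) (hB : Injective dB) (hA : Surjective dA) : Injective dD := by
  obtain ⟨i0, p0, i1, p1, c1, c2, ii0, sp0, e0, ii1, sp1, e1⟩ := h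
  rw [injective_iff_map_eq_zero dD]
  intro x hx
  obtain ⟨y, rfl⟩ := sp0 x
  rw [c2] at hx
  obtain ⟨z, hz⟩ := (e1 _).1 hx
  obtain ⟨w, rfl⟩ := hA z
  rw [← c1] at hz
  rw [← hB hz]
  exact (e0 _).2 ⟨w, rfl⟩

theorem SE2.surjA (h : SE2 dA dB dD) (hB : Surjective dB) (hD : Injective dD) :
    Surjective dA := by
  obtain ⟨i0, p0, i1, p1, c1, c2, ii0, sp0, e0, ii1, sp1, e1⟩ := h
  intro c
  obtain ⟨x, hx⟩ := hB (i1 c)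
  have : p0 x = 0 := hD (by rw [c2, hx, map_zero]; exact (e1 _).2 ⟨c, rfl⟩)
  obtain ⟨y, rfl⟩ := (e0 x).1 this
  exact ⟨y, ii1 (by rw [← c1, hx])⟩
end

section
variable {A B C : Rep N}

theorem SES.cov (h : SES A B C) (Z : Rep N) : SE2 (d Z A) (d Z B) (d Z C) := by
  obtain ⟨i, p, hi, hp, ii, sp, e⟩ := h
  have hr : ∀ v, ∃ r : B.X v →ₗ[ℚ] A.X v, r ∘ₗ i v = LinearMap.id := fun v =>
    LinearMap.exists_leftInverse_of_injective _ (LinearMap.ker_eq_bot.2 (ii v))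
  have hs : ∀ v, ∃ s : C.X v →ₗ[ℚ] B.X v, p v ∘ₗ s = LinearMap.id := fun v =>
    LinearMap.exists_rightInverse_of_surjective _ (LinearMap.range_eq_top.2 (sp v))
  choose r hr using hr
  choose s hs using hs
  have pi0 : ∀ v x, p v (i v x) = 0 := fun v x => (e v _).2 ⟨x, rfl⟩
  have hrx : ∀ v x, p v x = 0 → i v (r v x) = x := by
    intro v x hx
    obtain ⟨y, rfl⟩ := (e v x).1 hx
    have := LinearMap.congr_fun (hr v) y
    simp at this; rw [this]
  have hsx : ∀ v x, p v (s v x) = x := fun v x => LinearMap.congr_fun (hs v) x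
  refine ⟨⟨⟨fun h => c0 i h, ?_⟩, ?_⟩, ⟨⟨fun h => c0 p h, ?_⟩, ?_⟩,
    ⟨⟨fun c v w a => i w ∘ₗ c v w a, ?_⟩, ?_⟩, ⟨⟨fun c v w a => p w ∘ₗ c v w a, ?_⟩, ?_⟩,
    ?_, ?_, ?_, ?_, ?_, ?_, ?_, ?_⟩
  · intro a b; funext v; ext x; simp [c0]
  · intro a b; funext v; ext x; simp [c0]
  · intro a b; funext v; ext x; simp [c0]
  · intro a b; funext v; ext x; simp [c0]
  · intro a b; funext v w t; ext x; simp
  · intro a b; funext v w t; ext x; simp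
  · intro a b; funext v w t; ext x; simp
  · intro a b; funext v w t; ext x; simp
  · intro h; funext v w t; ext x
    simp only [LinearMap.coe_mk, AddHom.coe_mk]; rw [d_comp, hi]; simp
  · intro h; funext v w t; ext x
    simp only [LinearMap.coe_mk, AddHom.coe_mk]; rw [d_comp, hp]; simp
  · intro a b hab; funext v; ext x
    exact ii v (LinearMap.congr_fun (congrFun hab v) x)
  · intro c
    refine ⟨fun v => s v ∘ₗ c v, ?_⟩
    funext v; ext x; simp [c0, hsx]
  · intro c
    constructor
    · intro hc
      refine ⟨fun v => r v ∘ₗ c v, ?_⟩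
      funext v; ext x
      exact hrx v _ (LinearMap.congr_fun (congrFun hc v) x)
    · rintro ⟨b, rfl⟩
      funext v; ext x; simp [c0, pi0]
  · intro a b hab; funext v w t; ext x
    exact ii w (LinearMap.congr_fun (congrFun (congrFun (congrFun hab v) w) t) x)
  · intro c
    refine ⟨fun v w t => s w ∘ₗ c v w t, ?_⟩
    funext v w t; ext x; simp [hsx]
  · intro c
    constructor
    · intro hc
      refine ⟨fun v w t => r w ∘ₗ c v w t, ?_⟩
      funext v w t; ext x
      exact hrx w _ (LinearMap.congr_fun (congrFun (congrFun (congrFun hc v) w) t) x)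
    · rintro ⟨b, rfl⟩
      funext v w t; ext x; simp [pi0]

theorem SES.con (h : SES A B C) (Z : Rep N) : SE2 (d C Z) (d B Z) (d A Z) := by
  obtain ⟨i, p, hi, hp, ii, sp, e⟩ := h
  have hr : ∀ v, ∃ r : B.X v →ₗ[ℚ] A.X v, r ∘ₗ i v = LinearMap.id := fun v =>
    LinearMap.exists_leftInverse_of_injective _ (LinearMap.ker_eq_bot.2 (ii v))
  have hs : ∀ v, ∃ s : C.X v →ₗ[ℚ] B.X v, p v ∘ₗ s = LinearMap.id := fun v =>
    LinearMap.exists_rightInverse_of_surjective _ (LinearMap.range_eq_top.2 (sp v))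
  choose r hr using hr
  choose s hs using hs
  have pi0 : ∀ v x, p v (i v x) = 0 := fun v x => (e v _).2 ⟨x, rfl⟩
  have hsx : ∀ v x, p v (s v x) = x := fun v x => LinearMap.congr_fun (hs v) x
  have hrx : ∀ v x, r v (i v x) = x := fun v x => LinearMap.congr_fun (hr v) x
  have hdec : ∀ v x, ∃ y, x = s v (p v x) + i v y := by
    intro v x
    obtain ⟨y, hy⟩ := (e v (x - s v (p v x))).1 (by rw [map_sub, hsx, sub_self])
    exact ⟨y, by rw [hy]; abel⟩
  refine ⟨⟨⟨fun h => c0 h p, ?_⟩, ?_⟩, ⟨⟨fun h => c0 h i, ?_⟩, ?_⟩,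
    ⟨⟨fun c v w a => c v w a ∘ₗ p v, ?_⟩, ?_⟩, ⟨⟨fun c v w a => c v w a ∘ₗ i v, ?_⟩, ?_⟩,
    ?_, ?_, ?_, ?_, ?_, ?_, ?_, ?_⟩
  · intro a b; funext v; ext x; simp [c0]
  · intro a b; funext v; ext x; simp [c0]
  · intro a b; funext v; ext x; simp [c0]
  · intro a b; funext v; ext x; simp [c0]
  · intro a b; funext v w t; ext x; simp
  · intro a b; funext v w t; ext x; simp
  · intro a b; funext v w t; ext x; simp
  · intro a b; funext v w t; ext x; simp
  · intro h; funext v w t; ext x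
    simp only [LinearMap.coe_mk, AddHom.coe_mk]; rw [d_comp, hp]; simp
  · intro h; funext v w t; ext x
    simp only [LinearMap.coe_mk, AddHom.coe_mk]; rw [d_comp, hi]; simp
  · intro a b hab; funext v; ext x
    obtain ⟨y, rfl⟩ := sp v x
    exact (LinearMap.congr_fun (congrFun hab v) y)
  · intro c
    refine ⟨fun v => c v ∘ₗ r v, ?_⟩
    funext v; ext x; simp [c0, hrx]
  · intro c
    constructor
    · intro hc
      refine ⟨fun v => c v ∘ₗ s v, ?_⟩
      funext v; ext x
      obtain ⟨y, hy⟩ := hdec v x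
      have : c v (i v y) = 0 := (LinearMap.congr_fun (congrFun hc v) y)
      conv_rhs => rw [hy, map_add, this, add_zero]
      rfl
    · rintro ⟨b, rfl⟩
      funext v; ext x; simp [c0, pi0]
  · intro a b hab; funext v w t; ext x
    obtain ⟨y, rfl⟩ := sp v x
    exact (LinearMap.congr_fun (congrFun (congrFun (congrFun hab v) w) t) y)
  · intro c
    refine ⟨fun v w t => c v w t ∘ₗ r v, ?_⟩
    funext v w t; ext x; simp [hrx]
  · intro c
    constructor
    · intro hc
      refine ⟨fun v w t => c v w t ∘ₗ s v, ?_⟩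
      funext v w t; ext x
      obtain ⟨y, hy⟩ := hdec v x
      have : c v w t (i v y) = 0 := (LinearMap.congr_fun (congrFun (congrFun (congrFun hc v) w) t) y)
      conv_rhs => rw [hy, map_add, this, add_zero]
      rfl
    · rintro ⟨b, rfl⟩
      funext v w t; ext x; simp [pi0]

theorem SES.dim (h : SES A B C) : dim B = dim A + dim C := by
  obtain ⟨i, p, hi, hp, ii, sp, e⟩ := h
  ext v
  rw [Finsupp.add_apply, dim_apply, dim_apply, dim_apply]
  have h1 := LinearMap.finrank_range_add_finrank_ker (p v)
  rw [LinearMap.range_eq_top.2 (sp v), finrank_top] at h1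
  have h2 : LinearMap.ker (p v) = LinearMap.range (i v) := LinearMap.exact_iff.1 (e v)
  rw [h2, LinearMap.finrank_range_of_inj (ii v)] at h1
  omega
end

end SK


namespace SK
open Module
variable {V : Type} {N : V → V → ℕ}

theorem pi_fin {I : Type} (M : I → Type) [∀ i, AddCommGroup (M i)] [∀ i, Module ℚ (M i)]
    [∀ i, FiniteDimensional ℚ (M i)] (S : Finset I) (h : ∀ i, i ∉ S → Subsingleton (M i)) :
    FiniteDimensional ℚ (∀ i, M i) ∧ finrank ℚ (∀ i, M i) = ∑ i ∈ S, finrank ℚ (M i) := by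
  classical
  let φ : (∀ i, M i) →ₗ[ℚ] (∀ i : S, M i) :=
    { toFun := fun f i => f i
      map_add' := fun _ _ => rfl
      map_smul' := fun _ _ => rfl }
  have hφ : Function.Bijective φ := by
    constructor
    · intro a b hab
      funext i
      by_cases hi : i ∈ S
      · exact congrFun hab ⟨i, hi⟩
      · have := h i hi
        exact Subsingleton.elim _ _
    · intro b
      refine ⟨fun i => if hi : i ∈ S then b ⟨i, hi⟩ else 0, ?_⟩
      funext i
      simp [φ]
  let e := LinearEquiv.ofBijective φ hφ
  refine ⟨e.symm.finiteDimensional, ?_⟩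
  rw [e.finrank_eq, Module.finrank_pi_fintype]
  exact (Finset.sum_coe_sort S (fun i => finrank ℚ (M i)))

theorem C0_fin (X Y : Rep N) : FiniteDimensional ℚ (C0 X Y) ∧
    finrank ℚ (C0 X Y) = ∑ v ∈ X.S, finrank ℚ (X.X v) * finrank ℚ (Y.X v) := by
  have := pi_fin (fun v => X.X v →ₗ[ℚ] Y.X v) X.S (fun v hv => by
    have := X.hS v hv
    exact ⟨fun a b => by ext x; rw [Subsingleton.elim x 0]; simp⟩)
  simpa [Module.finrank_linearMap] using this

theorem C1_fin (X Y : Rep N) : FiniteDimensional ℚ (C1 X Y) ∧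
    finrank ℚ (C1 X Y) = ∑ v ∈ X.S, ∑ w ∈ Y.S,
      N v w * (finrank ℚ (X.X v) * finrank ℚ (Y.X w)) := by
  have h1 : ∀ v, FiniteDimensional ℚ (∀ w, Fin (N v w) → (X.X v →ₗ[ℚ] Y.X w)) ∧ 
     finrank ℚ (∀ w, Fin (N v w) → (X.X v →ₗ[ℚ] Y.X w)) = _ := fun v =>
    pi_fin (fun w => Fin (N v w) → (X.X v →ₗ[ℚ] Y.X w)) Y.S (fun w hw => by
      have := Y.hS w hw
      exact ⟨fun a b => by funext t; ext x; exact Subsingleton.elim _ _⟩)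
  have i1 := fun v => (h1 v).1
  have := pi_fin (fun v => ∀ w, Fin (N v w) → (X.X v →ₗ[ℚ] Y.X w)) X.S (fun v hv => by
      have := X.hS v hv
      exact ⟨fun a b => by funext w t; ext x; rw [Subsingleton.elim x 0]; simp⟩)
  refine ⟨this.1, this.2.trans ?_⟩
  refine Finset.sum_congr rfl fun v _ => (h1 v).2.trans ?_
  refine Finset.sum_congr rfl fun w _ => ?_
  rw [Module.finrank_pi_fintype]
  simp [Module.finrank_linearMap]

instance (X Y : Rep N) : FiniteDimensional ℚ (C0 X Y) := (C0_fin X Y).1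
instance (X Y : Rep N) : FiniteDimensional ℚ (C1 X Y) := (C1_fin X Y).1

noncomputable def hom (X Y : Rep N) : ℕ := finrank ℚ (LinearMap.ker (d X Y))
noncomputable def ext (X Y : Rep N) : ℕ := finrank ℚ (C1 X Y ⧸ LinearMap.range (d X Y))

open Classical in
/-- Euler form -/
noncomputable def E (N : V → V → ℕ) : (V →₀ ℤ) →ₗ[ℤ] (V →₀ ℤ) →ₗ[ℤ] ℤ :=
  Finsupp.linearCombination ℤ (fun v => Finsupp.linearCombination ℤ
    (fun w => ((if v = w then 1 else 0) - N v w : ℤ)))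

open Classical in
theorem E_sum (u w : V →₀ ℤ) (S T : Finset V) (hS : u.support ⊆ S) (hT : w.support ⊆ T) :
    E N u w = ∑ v ∈ S, ∑ v' ∈ T, u v * (w v' * ((if v = v' then 1 else 0) - N v v' : ℤ)) := by
  rw [E, Finsupp.linearCombination_apply, Finsupp.sum_of_support_subset _ hS _ (by simp),
    LinearMap.sum_apply]
  refine Finset.sum_congr rfl fun v _ => ?_
  rw [LinearMap.smul_apply, Finsupp.linearCombination_apply,
    Finsupp.sum_of_support_subset _ hT _ (by simp), Finset.smul_sum]
  rfl

theorem euler (X Y : Rep N) : (hom X Y : ℤ) - ext X Y = E N (dim X) (dim Y) := by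
  classical
  have h1 := LinearMap.finrank_range_add_finrank_ker (d X Y)
  have h2 := Submodule.finrank_quotient_add_finrank (LinearMap.range (d X Y))
  have h3 := (C0_fin X Y).2
  have h4 := (C1_fin X Y).2
  have : (hom X Y : ℤ) - ext X Y = finrank ℚ (C0 X Y) - finrank ℚ (C1 X Y) := by
    unfold hom ext; omega
  rw [this, h3, h4, E_sum (dim X) (dim Y) X.S Y.S Finsupp.support_onFinset_subset Finsupp.support_onFinset_subset]
  push_cast
  rw [← Finset.sum_sub_distrib]
  refine Finset.sum_congr rfl fun v _ => ?_
  simp only [dim_apply, mul_sub, Finset.sum_sub_distrib]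
  congr 1
  · simp only [mul_ite, mul_one, mul_zero, Finset.sum_ite_eq]
    split_ifs with h
    · rfl
    · have := Y.hS v h
      simp [finrank_zero_of_subsingleton]
  · refine Finset.sum_congr rfl fun w _ => ?_
    ring

theorem homZ_iff (X Y : Rep N) : HomZ X Y ↔ hom X Y = 0 := by
  rw [hom, Submodule.finrank_eq_zero, LinearMap.ker_eq_bot]; rfl

theorem extZ_iff (X Y : Rep N) : ExtZ X Y ↔ ext X Y = 0 := by
  rw [ext, ExtZ, ← LinearMap.range_eq_top, Module.finrank_zero_iff, Submodule.Quotient.subsingleton_iff]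

def c0id (X : Rep N) : C0 X X := fun _ => LinearMap.id

theorem c0id_hom (X : Rep N) : d X X (c0id X) = 0 := is_hom_of (by intros; rfl)

/-- endomorphisms of bricks are scalars -/
theorem scalar {X : Rep N} (hX : ExtZ X X) (hE : E N (dim X) (dim X) = 1) (h : C0 X X)
    (hh : d X X h = 0) : ∃ c : ℚ, h = c • c0id X := by
  have h1 := euler X X
  rw [(extZ_iff X X).1 hX, hE] at h1
  have h2 : finrank ℚ (LinearMap.ker (d X X)) = 1 := by unfold hom at h1; omega
  have hne : (⟨c0id X, c0id_hom X⟩ : LinearMap.ker (d X X)) ≠ 0 := by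
    intro h0
    have h0 : c0id X = 0 := congrArg Subtype.val h0
    have hd : dim X = 0 := by
      ext v
      rw [dim_apply]
      have : Subsingleton (X.X v) := ⟨fun a b => by
        have := fun x => LinearMap.congr_fun (congrFun h0 v) x
        simp [c0id] at this
        rw [this a, this b]⟩
      simp [finrank_zero_of_subsingleton]
    rw [hd] at hE
    simp at hE
  obtain ⟨c, hc⟩ := (finrank_eq_one_iff_of_nonzero' _ hne).1 h2 ⟨h, hh⟩
  exact ⟨c, (congrArg Subtype.val hc).symm⟩

/-! products -/
noncomputable def prodRep {τ : Type} [Fintype τ] (K : τ → Rep N) : Rep N where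
  X v := ∀ t, (K t).X v
  f v w a := LinearMap.pi (fun t => (K t).f v w a ∘ₗ LinearMap.proj t)
  S := by classical exact Finset.univ.biUnion (fun t => (K t).S)
  hS v hv := by
    classical
    simp only [Finset.mem_biUnion, Finset.mem_univ, true_and, not_exists] at hv
    have := fun t => (K t).hS v (hv t)
    infer_instance

theorem prodRep_dim {τ : Type} [Fintype τ] (K : τ → Rep N) :
    dim (prodRep K) = ∑ t, dim (K t) := by
  ext v
  rw [dim_apply, Finsupp.finsetSum_apply]
  change ((finrank ℚ (∀ t, (K t).X v) : ℕ) : ℤ) = _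
  rw [Module.finrank_pi_fintype]; push_cast; rfl

section
variable {τ : Type} [Fintype τ] (K : τ → Rep N)

def pr (t : τ) : C0 (prodRep K) (K t) := fun _ => LinearMap.proj t
theorem pr_hom (t : τ) : d _ _ (pr K t) = 0 := is_hom_of (by intros; rfl)

open Classical in
noncomputable def inj (t : τ) : C0 (K t) (prodRep K) := fun v =>
  LinearMap.single ℚ (fun t => (K t).X v) t
theorem pr_inj_same (t : τ) (v : V) (x : (K t).X v) : pr K t v (inj K t v x) = x := by
  classical
  exact Pi.single_eq_same (M := fun t => (K t).X v) t x
theorem pr_inj_ne {s t : τ} (h : s ≠ t) (v : V) (x : (K t).X v) : pr K s v (inj K t v x) = 0 := by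
  classical
  exact Pi.single_eq_of_ne (M := fun t => (K t).X v) h x
theorem pr_ext {v : V} {x y : (prodRep K).X v} (h : ∀ t, pr K t v x = pr K t v y) : x = y :=
  funext h

theorem inj_hom (t : τ) : d _ _ (inj K t) = 0 := is_hom_of (by
  intro v w a x
  apply pr_ext
  intro s
  rw [← is_hom_apply (pr_hom K s)]
  by_cases h : s = t
  · subst h; rw [pr_inj_same, pr_inj_same]
  · rw [pr_inj_ne K h, pr_inj_ne K h, map_zero])

theorem prod_ext_l {W : Rep N} {v w : V} (g h : (prodRep K).X v →ₗ[ℚ] W.X w)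
    (H : ∀ t, g ∘ₗ inj K t v = h ∘ₗ inj K t v) : g = h := by
  classical
  have key : ∀ x, x = ∑ t, inj K t v (pr K t v x) := by
    intro x
    apply pr_ext
    intro s
    rw [map_sum, Finset.sum_eq_single s]
    · rw [pr_inj_same]
    · intro b _ hb
      rw [pr_inj_ne K hb.symm]
    · simp
  ext x
  rw [key x, map_sum, map_sum]
  exact Finset.sum_congr rfl fun t _ => LinearMap.congr_fun (H t) _

theorem prod_homZ_r {W : Rep N} (h : ∀ t, HomZ W (K t)) : HomZ W (prodRep K) := by
  rw [HomZ_iff]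
  intro g hg
  funext v; ext x; funext t
  have := (HomZ_iff _ _).1 (h t) (c0 (pr K t) g) (comp_hom (pr_hom K t) hg)
  exact LinearMap.congr_fun (congrFun this v) x

theorem prod_extZ_r {W : Rep N} (h : ∀ t, ExtZ W (K t)) : ExtZ W (prodRep K) := by
  intro c
  choose g hg using fun t => h t (fun v w a => pr K t w ∘ₗ c v w a)
  refine ⟨fun v => LinearMap.pi (fun t => g t v), ?_⟩
  funext v w a; ext x; funext t
  exact LinearMap.congr_fun (congrFun (congrFun (congrFun (hg t) v) w) a) x

theorem prod_homZ_l {W : Rep N} (h : ∀ t, HomZ (K t) W) : HomZ (prodRep K) W := by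
  rw [HomZ_iff]
  intro g hg
  funext v
  apply prod_ext_l
  intro t
  have := (HomZ_iff _ _).1 (h t) (c0 g (inj K t)) (comp_hom hg (inj_hom K t))
  exact (congrFun this v)

theorem prod_extZ_l {W : Rep N} (h : ∀ t, ExtZ (K t) W) : ExtZ (prodRep K) W := by
  classical
  intro c
  choose g hg using fun t => h t (fun v w a => c v w a ∘ₗ inj K t v)
  have key : ∀ v t, (∑ s, g s v ∘ₗ pr K s v) ∘ₗ inj K t v = g t v := by
    intro v t
    ext x
    rw [LinearMap.comp_apply, LinearMap.sum_apply, Finset.sum_eq_single t]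
    · rw [LinearMap.comp_apply, pr_inj_same]
    · intro b _ hb
      rw [LinearMap.comp_apply, pr_inj_ne K hb, map_zero]
    · simp
  refine ⟨fun v => ∑ s, g s v ∘ₗ pr K s v, ?_⟩
  funext v w a
  apply prod_ext_l
  intro t
  have h1 := congrFun (congrFun (congrFun (hg t) v) w) a
  rw [← h1]
  ext x
  have h2 := d_comp (fun v => ∑ s, g s v ∘ₗ pr K s v : C0 (prodRep K) W) (inj K t) v w a x
  rw [inj_hom] at h2
  have h3 : c0 (fun v => ∑ s, g s v ∘ₗ pr K s v : C0 (prodRep K) W) (inj K t) = g t := by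
    funext v; exact key v t
  rw [h3] at h2
  rw [h2]; simp

theorem prod_extZ_r' {W : Rep N} (h : ExtZ W (prodRep K)) (t : τ) : ExtZ W (K t) := by
  intro c
  obtain ⟨g, hg⟩ := h (fun v w a => inj K t w ∘ₗ c v w a)
  refine ⟨c0 (pr K t) g, ?_⟩
  funext v w a; ext x
  rw [d_comp, pr_hom, hg]
  simp [pr_inj_same]

theorem prod_extZ_l' {W : Rep N} (h : ExtZ (prodRep K) W) (t : τ) : ExtZ (K t) W := by
  intro c
  obtain ⟨g, hg⟩ := h (fun v w a => c v w a ∘ₗ pr K t v)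
  refine ⟨c0 g (inj K t), ?_⟩
  funext v w a; ext x
  rw [d_comp, inj_hom, hg]
  simp [pr_inj_same]
end

def AddT {I : Type} (κ : I → Rep N) (T : Rep N) : Prop :=
  (∀ W, (∀ p, HomZ W (κ p)) → HomZ W T) ∧ (∀ W, (∀ p, ExtZ W (κ p)) → ExtZ W T) ∧
  (∀ W, (∀ p, HomZ (κ p) W) → HomZ T W) ∧ (∀ W, (∀ p, ExtZ (κ p) W) → ExtZ T W)

theorem addT_prod {I τ : Type} [Fintype τ] (κ : I → Rep N) (φ : τ → I) :
    AddT κ (prodRep (fun t => κ (φ t))) :=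
  ⟨fun _ h => prod_homZ_r _ (fun _ => h _), fun _ h => prod_extZ_r _ (fun _ => h _),
   fun _ h => prod_homZ_l _ (fun _ => h _), fun _ h => prod_extZ_l _ (fun _ => h _)⟩

/-! sub and quotient -/
def subRep (X : Rep N) (U : ∀ v, Submodule ℚ (X.X v))
    (hU : ∀ v w a x, x ∈ U v → X.f v w a x ∈ U w) : Rep N where
  X v := U v
  f v w a := (X.f v w a).restrict (hU v w a)
  S := X.S
  hS v hv := by have := X.hS v hv; infer_instance

def quotRep (X : Rep N) (U : ∀ v, Submodule ℚ (X.X v))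
    (hU : ∀ v w a x, x ∈ U v → X.f v w a x ∈ U w) : Rep N where
  X v := X.X v ⧸ U v
  f v w a := (U v).mapQ (U w) (X.f v w a) (hU v w a)
  S := X.S
  hS v hv := by have := X.hS v hv; infer_instance

theorem ses_sub_quot (X : Rep N) (U : ∀ v, Submodule ℚ (X.X v))
    (hU : ∀ v w a x, x ∈ U v → X.f v w a x ∈ U w) :
    SES (subRep X U hU) X (quotRep X U hU) := by
  refine ⟨fun v => (U v).subtype, fun v => (U v).mkQ, is_hom_of (by intros; rfl),
    is_hom_of (by intros; rfl), fun v => Subtype.val_injective, fun v => (U v).mkQ_surjective, ?_⟩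
  intro v x
  exact ⟨fun hx => ⟨⟨x, (Submodule.Quotient.mk_eq_zero _).1 hx⟩, rfl⟩,
    fun ⟨y, hy⟩ => hy ▸ (Submodule.Quotient.mk_eq_zero _).2 y.2⟩

theorem ses_quot {A X : Rep N} (f : C0 A X) (hf : d A X f = 0) (hi : ∀ v, Function.Injective (f v)) :
    ∃ Q, SES A X Q ∧ ∃ p : C0 X Q, d X Q p = 0 ∧ (∀ v, Function.Surjective (p v)) ∧
      ∀ v, Function.Exact (f v) (p v) := by
  have hU : ∀ v w a x, x ∈ LinearMap.range (f v) → X.f v w a x ∈ LinearMap.range (f w) := by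
    rintro v w a _ ⟨x, rfl⟩
    exact ⟨A.f v w a x, (is_hom_apply hf v w a x).symm⟩
  have h2 : ∀ v, Function.Exact (f v) ((LinearMap.range (f v)).mkQ) := by
    intro v; rw [LinearMap.exact_iff]; simp
  refine ⟨quotRep X (fun v => LinearMap.range (f v)) hU,
    ⟨f, fun v => (LinearMap.range (f v)).mkQ, hf, is_hom_of (by intros; rfl), hi,
      fun v => Submodule.mkQ_surjective _, h2⟩, fun v => (LinearMap.range (f v)).mkQ,
      is_hom_of (by intros; rfl), fun v => Submodule.mkQ_surjective _, h2⟩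

theorem ses_ker {X C : Rep N} (f : C0 X C) (hf : d X C f = 0) (hi : ∀ v, Function.Surjective (f v)) :
    ∃ K, SES K X C := by
  have hU : ∀ v w a x, x ∈ LinearMap.ker (f v) → X.f v w a x ∈ LinearMap.ker (f w) := by
    intro v w a x hx
    rw [LinearMap.mem_ker] at *
    rw [← is_hom_apply hf, hx, map_zero]
  refine ⟨subRep X (fun v => LinearMap.ker (f v)) hU,
    ⟨fun v => (LinearMap.ker (f v)).subtype, f, is_hom_of (by intros; rfl), hf,
     fun v => Subtype.val_injective, hi, ?_⟩⟩
  intro v x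
  exact ⟨fun hx => ⟨⟨x, hx⟩, rfl⟩, fun ⟨y, hy⟩ => hy ▸ y.2⟩

/-- image factorisation -/
theorem image_fac {X C : Rep N} (f : C0 X C) (hf : d X C f = 0) :
    ∃ (I : Rep N) (g : C0 X I) (j : C0 I C), d X I g = 0 ∧ d I C j = 0 ∧
      (∀ v, Function.Surjective (g v)) ∧ (∀ v, Function.Injective (j v)) ∧ f = c0 j g := by
  have hU : ∀ v w a x, x ∈ LinearMap.range (f v) → C.f v w a x ∈ LinearMap.range (f w) := by
    rintro v w a _ ⟨x, rfl⟩
    exact ⟨X.f v w a x, (is_hom_apply hf v w a x).symm⟩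
  refine ⟨subRep C (fun v => LinearMap.range (f v)) hU, fun v => (f v).rangeRestrict,
    fun v => (LinearMap.range (f v)).subtype, ?_, is_hom_of (by intros; rfl),
    fun v => LinearMap.surjective_rangeRestrict _, fun v => Subtype.val_injective, rfl⟩
  apply is_hom_of
  intro v w a x
  apply Subtype.ext
  exact is_hom_apply hf v w a x

end SK


namespace SK
open Module
variable {V : Type} {N : V → V → ℕ}

theorem prod_sum {τ : Type} [Fintype τ] (K : τ → Rep N) {W : Rep N} {v w : V}
    (g : (prodRep K).X v →ₗ[ℚ] W.X w) (x : (prodRep K).X v) :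
    g x = ∑ t, g (inj K t v (pr K t v x)) := by
  have h : g = ∑ t, g ∘ₗ inj K t v ∘ₗ pr K t v := by
    apply prod_ext_l
    intro s
    ext y
    rw [LinearMap.comp_apply, LinearMap.comp_apply, LinearMap.sum_apply, Finset.sum_eq_single s]
    · simp [pr_inj_same]
    · intro b _ hb
      simp [pr_inj_ne K hb]
    · simp
  conv_lhs => rw [h, LinearMap.sum_apply]
  rfl

theorem retraction {I T Q : Rep N} (j : C0 I T) (p : C0 T Q) (hj : d I T j = 0) (hp : d T Q p = 0)
    (ij : ∀ v, Function.Injective (j v)) (sp : ∀ v, Function.Surjective (p v))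
    (e : ∀ v, Function.Exact (j v) (p v)) (hx : ExtZ Q I) :
    ∃ ρ : C0 T I, d T I ρ = 0 ∧ ∀ v x, ρ v (j v x) = x := by
  have hr : ∀ v, ∃ r : T.X v →ₗ[ℚ] I.X v, r ∘ₗ j v = LinearMap.id := fun v =>
    LinearMap.exists_leftInverse_of_injective _ (LinearMap.ker_eq_bot.2 (ij v))
  have hs : ∀ v, ∃ s : Q.X v →ₗ[ℚ] T.X v, p v ∘ₗ s = LinearMap.id := fun v =>
    LinearMap.exists_rightInverse_of_surjective _ (LinearMap.range_eq_top.2 (sp v))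
  choose r hr using hr
  choose s hs using hs
  have pi0 : ∀ v x, p v (j v x) = 0 := fun v x => (e v _).2 ⟨x, rfl⟩
  have hsx : ∀ v x, p v (s v x) = x := fun v x => LinearMap.congr_fun (hs v) x
  have hrx : ∀ v x, r v (j v x) = x := fun v x => LinearMap.congr_fun (hr v) x
  have hdec : ∀ v x, ∃ y, x = s v (p v x) + j v y := by
    intro v x
    obtain ⟨y, hy⟩ := (e v (x - s v (p v x))).1 (by rw [map_sub, hsx, sub_self])
    exact ⟨y, by rw [hy]; abel⟩
  obtain ⟨h, hh⟩ := hx (fun v w a => d T I r v w a ∘ₗ s v)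
  have h1 : ∀ v w a x, d T I r v w a (j v x) = 0 := by
    intro v w a x
    rw [d_apply, hrx, is_hom_apply hj, hrx, sub_self]
  refine ⟨r - c0 h p, ?_, ?_⟩
  · funext v w a; ext x
    rw [map_sub]
    change d T I r v w a x - d T I (c0 h p) v w a x = 0
    rw [d_comp, hp, hh]
    obtain ⟨y, hy⟩ := hdec v x
    have h2 : d T I r v w a x = d T I r v w a (s v (p v x)) := by
      conv_lhs => rw [hy, map_add, h1, add_zero]
    rw [h2]
    simp
  · intro v x
    change r v (j v x) - h v (p v (j v x)) = x
    rw [hrx, pi0]; simp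

theorem UM (y : Rep N) (κ : ℕ → Rep N) (hk : ∀ p q, p ≠ q → HomZ (κ p) (κ q))
    (hr : ∀ p, ExtZ (κ p) (κ p)) (hE : ∀ p, E N (dim (κ p)) (dim (κ p)) = 1)
    (eky : ∀ p, ExtZ (κ p) y) (ry : ExtZ y y) (Ey : E N (dim y) (dim y) = 1)
    (F : Finset ℕ) (hF : ∀ p, p ∉ F → HomZ y (κ p)) :
    ∃ T Z : Rep N, AddT κ T ∧ (∀ p, ¬ HomZ y (κ p) → ∀ W, ExtZ W T → ExtZ W (κ p)) ∧
      dim T = ∑ p ∈ F, (hom y (κ p) : ℤ) • dim (κ p) ∧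
      ((SES y T Z ∧ ∀ p, HomZ Z (κ p)) ∨ SES Z y T) := by
  classical
  let τ := Σ p : F, Fin (hom y (κ p))
  let φ : τ → ℕ := fun t => t.1.1
  let K : τ → Rep N := fun t => κ (φ t)
  let b : ∀ p : ℕ, Basis (Fin (hom y (κ p))) ℚ (LinearMap.ker (d y (κ p))) :=
    fun p => Module.finBasis ℚ _
  let β : ∀ t : τ, C0 y (K t) := fun t => (b t.1 t.2).1
  have hβ : ∀ t, d _ _ (β t) = 0 := fun t => (b t.1 t.2).2
  let f : C0 y (prodRep K) := fun v => LinearMap.pi (fun t => β t v)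
  have hprf : ∀ t v x, pr K t v (f v x) = β t v x := fun t v x => rfl
  have hf : d y (prodRep K) f = 0 := by
    apply is_hom_of
    intro v w a x
    apply pr_ext
    intro t
    rw [← is_hom_apply (pr_hom K t), hprf, hprf, is_hom_apply (hβ t)]
  have hAdd : AddT κ (prodRep K) := addT_prod κ φ
  have key : ∀ p (g : C0 (prodRep K) (κ p)), d _ _ g = 0 → (∀ v x, g v (f v x) = 0) → g = 0 := by
    intro p g hg hgf
    have hne : ∀ t : τ, φ t ≠ p → c0 g (inj K t) = 0 := fun t ht =>
      (HomZ_iff _ _).1 (hk _ _ ht) _ (comp_hom hg (inj_hom K t))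
    by_cases hp : p ∈ F
    · let ti : Fin (hom y (κ p)) → τ := fun i => ⟨⟨p, hp⟩, i⟩
      have hsc : ∀ i, ∃ c : ℚ, c0 g (inj K (ti i)) = c • c0id (κ p) := fun i =>
        scalar (hr p) (hE p) _ (comp_hom hg (inj_hom K (ti i)))
      choose c hc using hsc
      have hsum : ∑ i, c i • b p i = 0 := by
        apply Subtype.ext
        funext v; ext x
        have h1 := hgf v x
        rw [prod_sum, Fintype.sum_sigma, Finset.sum_eq_single (⟨p, hp⟩ : F)] at h1
        · rw [ZeroMemClass.coe_zero]
          change _ = (0 : (κ p).X v)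
          rw [← h1]
          simp only [Submodule.coe_sum, Finset.sum_apply, LinearMap.sum_apply]
          refine Finset.sum_congr rfl fun i _ => ?_
          have := LinearMap.congr_fun (congrFun (hc i) v) (β (ti i) v x)
          exact this.symm
        · intro q _ hq
          refine Finset.sum_eq_zero fun i _ => ?_
          have h2 := hne ⟨q, i⟩ (fun h => hq (Subtype.ext h))
          exact LinearMap.congr_fun (congrFun h2 v) _
        · simp
      have hc0 : ∀ i, c i = 0 := Fintype.linearIndependent_iff.1 (b p).linearIndependent c hsum
      funext v
      apply prod_ext_l
      rintro ⟨⟨q, hq⟩, i⟩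
      by_cases hqp : q = p
      · subst hqp
        have := congrFun (hc i) v
        rw [hc0, zero_smul] at this
        exact this
      · exact congrFun (hne ⟨⟨q, hq⟩, i⟩ hqp) v
    · funext v
      apply prod_ext_l
      rintro ⟨⟨q, hq⟩, i⟩
      exact congrFun (hne ⟨⟨q, hq⟩, i⟩ (fun h => hp (h ▸ hq))) v
  have h2 : ∀ p, ¬ HomZ y (κ p) → ∀ W, ExtZ W (prodRep K) → ExtZ W (κ p) := by
    intro p hp W hW
    have hpF : p ∈ F := by by_contra h; exact hp (hF p h)
    rw [homZ_iff] at hp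
    exact prod_extZ_r' K hW ⟨⟨p, hpF⟩, ⟨0, Nat.pos_of_ne_zero hp⟩⟩
  have h3 : dim (prodRep K) = ∑ p ∈ F, (hom y (κ p) : ℤ) • dim (κ p) := by
    rw [prodRep_dim, Fintype.sum_sigma, ← Finset.sum_coe_sort F]
    refine Finset.sum_congr rfl fun p _ => ?_
    simp [K, φ]
  by_cases hm : ∀ v, Function.Injective (f v)
  · obtain ⟨Z, hZ, p, hp, sp, ex⟩ := ses_quot f hf hm
    refine ⟨_, Z, hAdd, h2, h3, Or.inl ⟨hZ, ?_⟩⟩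
    intro q
    rw [HomZ_iff]
    intro h hh
    have h0 := key q (c0 h p) (comp_hom hh hp) (by
      intro v x
      have : p v (f v x) = 0 := (ex v _).2 ⟨x, rfl⟩
      simp [c0, this])
    funext v; ext x
    obtain ⟨z, rfl⟩ := sp v x
    exact LinearMap.congr_fun (congrFun h0 v) z
  · have hep : ∀ v, Function.Surjective (f v) := by
      obtain ⟨I, g, j, hg, hj, sg, ij, hfj⟩ := image_fac f hf
      have hIy : HomZ I y := by
        rw [HomZ_iff]
        intro h hh
        obtain ⟨c, hc⟩ := scalar ry Ey (c0 h g) (comp_hom hh hg)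
        have hcx : ∀ v x, h v (g v x) = c • x := fun v x => LinearMap.congr_fun (congrFun hc v) x
        have hc0 : c = 0 := by
          by_contra hc0
          apply hm
          intro v x x' hxx
          rw [hfj] at hxx
          have h5 := ij v hxx
          have h6 := hcx v x
          rw [h5, hcx v x'] at h6
          exact (smul_right_injective _ hc0 h6).symm
        funext v; ext x
        obtain ⟨z, rfl⟩ := sg v x
        rw [hcx, hc0, zero_smul]; rfl
      obtain ⟨Q, hQ, p, hp, sp, ex⟩ := ses_quot j hj ij
      have hTy : ExtZ (prodRep K) y := hAdd.2.2.2 y eky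
      have hQy : ExtZ Q y := (hQ.con y).surjA hTy hIy
      obtain ⟨Kr, hKr⟩ := ses_ker g hg sg
      have hQI : ExtZ Q I := (hKr.cov Q).surjD hQy
      obtain ⟨ρ, hρ, hρj⟩ := retraction j p hj hp ij sp ex hQI
      let e : C0 (prodRep K) (prodRep K) := c0id _ - c0 j ρ
      have he : d _ _ e = 0 := by
        rw [map_sub, c0id_hom, comp_hom hj hρ, sub_zero]
      have hex : ∀ v x, e v x = x - j v (ρ v x) := fun v x => rfl
      have hf' : ∀ v x, f v x = j v (g v x) := fun v x => by rw [hfj]; rfl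
      intro v x
      have : e v x = 0 := by
        apply pr_ext
        intro t
        have := key (φ t) (c0 (pr K t) e) (comp_hom (pr_hom K t) he) (by
          intro v x
          change pr K t v (e v (f v x)) = 0
          rw [hex, hf', hρj, sub_self, map_zero])
        rw [map_zero]
        exact LinearMap.congr_fun (congrFun this v) x
      rw [hex, sub_eq_zero] at this
      obtain ⟨z, hz⟩ := sg v (ρ v x)
      exact ⟨z, by rw [hf', hz, ← this]⟩
    obtain ⟨Z, hZ⟩ := ses_ker f hf hep
    exact ⟨_, Z, hAdd, h2, h3, Or.inr hZ⟩

/-- twisted extension -/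
noncomputable def extRep (T U : Rep N) (c : C1 U T) : Rep N where
  X v := T.X v × U.X v
  f v w a := ((T.f v w a).coprod (c v w a)).prod (U.f v w a ∘ₗ LinearMap.snd ℚ _ _)
  S := by classical exact T.S ∪ U.S
  hS v hv := by
    classical
    rw [Finset.mem_union, not_or] at hv
    have := T.hS v hv.1
    have := U.hS v hv.2
    infer_instance

noncomputable def exIn (T U : Rep N) (c : C1 U T) : C0 T (extRep T U c) := fun _ => LinearMap.inl ℚ _ _
noncomputable def exSnd (T U : Rep N) (c : C1 U T) : C0 (extRep T U c) U := fun _ => LinearMap.snd ℚ _ _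
noncomputable def exFst (T U : Rep N) (c : C1 U T) : C0 (extRep T U c) T := fun _ => LinearMap.fst ℚ _ _
noncomputable def exInr (T U : Rep N) (c : C1 U T) : C0 U (extRep T U c) := fun _ => LinearMap.inr ℚ _ _

section
variable (T U : Rep N) (c : C1 U T)
theorem exIn_hom : d _ _ (exIn T U c) = 0 := is_hom_of (by
  intro v w a x
  change (T.f v w a x + c v w a 0, U.f v w a 0) = (T.f v w a x, 0)
  simp)
theorem exSnd_hom : d _ _ (exSnd T U c) = 0 := is_hom_of (by intros; rfl)
theorem exFst_d (v w a x) : d _ _ (exFst T U c) v w a x = - c v w a (exSnd T U c v x) := by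
  rw [d_apply]
  change T.f v w a x.1 - (T.f v w a x.1 + c v w a x.2) = - c v w a x.2
  abel
theorem ex_dec (v) (x : (extRep T U c).X v) :
    x = exIn T U c v (exFst T U c v x) + exInr T U c v (exSnd T U c v x) := by
  have h : ∀ y : T.X v × U.X v, y = (y.1, 0) + (0, y.2) := fun y => by simp
  exact h x
theorem ex_ses : SES T (extRep T U c) U :=
  ⟨exIn T U c, exSnd T U c, exIn_hom T U c, exSnd_hom T U c,
    fun _ _ _ h => congrArg Prod.fst h, fun _ x => ⟨(0, x), rfl⟩, fun _ x =>
    ⟨fun h => ⟨x.1, Prod.ext rfl h.symm⟩, fun ⟨_, hz⟩ => hz ▸ rfl⟩⟩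
end

theorem UE (U : Rep N) (κ : ℕ → Rep N) (hk : ∀ p q, ExtZ (κ p) (κ q))
    (F : Finset ℕ) (hF : ∀ p, p ∉ F → ExtZ U (κ p)) :
    ∃ T U' : Rep N, SES T U' U ∧ (∀ p, ExtZ U' (κ p)) ∧ AddT κ T ∧
      (∀ p, ¬ ExtZ U (κ p) → ∀ W, ExtZ T W → ExtZ (κ p) W) ∧
      dim T = ∑ p ∈ F, (ext U (κ p) : ℤ) • dim (κ p) := by
  classical
  let τ := Σ p : F, Fin (ext U (κ p))
  let φ : τ → ℕ := fun t => t.1.1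
  let K : τ → Rep N := fun t => κ (φ t)
  let b : ∀ p : ℕ, Basis (Fin (ext U (κ p))) ℚ (C1 U (κ p) ⧸ LinearMap.range (d U (κ p))) :=
    fun p => Module.finBasis ℚ _
  have hl : ∀ p i, ∃ c : C1 U (κ p), (LinearMap.range (d U (κ p))).mkQ c = b p i := fun p i =>
    Submodule.mkQ_surjective _ _
  choose c hc using hl
  let cc : C1 U (prodRep K) := fun v w a => LinearMap.pi (fun t => c t.1 t.2 v w a)
  have hcc : ∀ t v w a x, pr K t w (cc v w a x) = c t.1 t.2 v w a x := fun _ _ _ _ _ => rfl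
  have hAdd : AddT κ (prodRep K) := addT_prod κ φ
  have h2 : ∀ p, ¬ ExtZ U (κ p) → ∀ W, ExtZ (prodRep K) W → ExtZ (κ p) W := by
    intro p hp W hW
    have hpF : p ∈ F := by by_contra h; exact hp (hF p h)
    rw [extZ_iff] at hp
    exact prod_extZ_l' K hW ⟨⟨p, hpF⟩, ⟨0, Nat.pos_of_ne_zero hp⟩⟩
  have h3 : dim (prodRep K) = ∑ p ∈ F, (ext U (κ p) : ℤ) • dim (κ p) := by
    rw [prodRep_dim, Fintype.sum_sigma, ← Finset.sum_coe_sort F]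
    refine Finset.sum_congr rfl fun p _ => ?_
    simp [K, φ]
  refine ⟨prodRep K, extRep (prodRep K) U cc, ex_ses _ _ _, ?_, hAdd, h2, h3⟩
  intro p e
  -- pull back of cocycles on U are coboundaries
  have hA : ∀ e' : C1 U (κ p), ∃ g : C0 (extRep (prodRep K) U cc) (κ p),
      d _ _ g = fun v w a => e' v w a ∘ₗ exSnd _ U cc v := by
    intro e'
    have hex : ∀ g : C0 U (κ p), ∃ g' : C0 (extRep (prodRep K) U cc) (κ p),
      d _ _ g' = fun v w a => d _ _ g v w a ∘ₗ exSnd _ U cc v := by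
      intro g
      refine ⟨c0 g (exSnd _ U cc), ?_⟩
      funext v w a; ext x
      rw [d_comp, exSnd_hom]; simp
    by_cases hp : p ∈ F
    · let ti : Fin (ext U (κ p)) → τ := fun i => ⟨⟨p, hp⟩, i⟩
      let lam := (b p).repr ((LinearMap.range (d U (κ p))).mkQ e')
      have h5 : (LinearMap.range (d U (κ p))).mkQ (e' - ∑ i, lam i • c p i) = 0 := by
        rw [map_sub, map_sum]
        simp only [map_smul, hc]
        rw [Basis.sum_repr, sub_self]
      rw [← LinearMap.mem_ker, Submodule.ker_mkQ] at h5
      obtain ⟨g, hg⟩ := h5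
      obtain ⟨g', hg'⟩ := hex g
      let γ : Fin (ext U (κ p)) → C0 (extRep (prodRep K) U cc) (κ p) :=
        fun i => c0 (pr K (ti i)) (exFst _ U cc)
      have h6 : ∀ i, d _ _ (γ i) = fun v w a => - (c p i v w a ∘ₗ exSnd _ U cc v) := by
        intro i
        funext v w a; ext x
        have := d_comp (pr K (ti i)) (exFst _ U cc) v w a x
        rw [pr_hom, exFst_d, map_neg, hcc] at this
        refine this.trans ?_
        change 0 + - c p i v w a (exSnd _ U cc v x) = - c p i v w a (exSnd _ U cc v x)
        rw [zero_add]
      have h7 : d _ _ (∑ i, lam i • γ i) =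
          fun v w a => - ((∑ i, lam i • c p i) v w a ∘ₗ exSnd _ U cc v) := by
        rw [map_sum]
        funext v w a; ext x
        simp only [map_smul, h6, Finset.sum_apply, Pi.smul_apply, LinearMap.sum_apply,
          LinearMap.smul_apply, LinearMap.neg_apply, LinearMap.comp_apply, smul_neg,
          Finset.sum_neg_distrib]
      refine ⟨g' - ∑ i, lam i • γ i, ?_⟩
      rw [map_sub, hg', hg, h7]
      funext v w a; ext x
      simp only [Pi.sub_apply, LinearMap.sub_apply, LinearMap.comp_apply, LinearMap.neg_apply]
      abel
    · obtain ⟨g, hg⟩ := hF p hp e'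
      obtain ⟨g', hg'⟩ := hex g
      exact ⟨g', by rw [hg', hg]⟩
  obtain ⟨h, hh⟩ := hAdd.2.2.2 (κ p) (fun q => hk q p) (fun v w a => e v w a ∘ₗ exIn _ U cc v)
  obtain ⟨g, hg⟩ := hA (fun v w a => 
    (e - d _ _ (c0 h (exFst _ U cc))) v w a ∘ₗ exInr _ U cc v)
  refine ⟨c0 h (exFst _ U cc) + g, ?_⟩
  rw [map_add, hg]
  funext v w a; ext x
  change d _ _ (c0 h (exFst _ U cc)) v w a x + (e v w a (exInr _ U cc v (exSnd _ U cc v x)) -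
    d _ _ (c0 h (exFst _ U cc)) v w a (exInr _ U cc v (exSnd _ U cc v x))) = e v w a x
  have h8 : d _ _ (c0 h (exFst _ U cc)) v w a (exIn _ U cc v (exFst _ U cc v x))
      = e v w a (exIn _ U cc v (exFst _ U cc v x)) := by
    rw [d_comp, hh, exFst_d]
    have h9 : exSnd _ U cc v (exIn _ U cc v (exFst _ U cc v x)) = 0 := rfl
    have h10 : exFst _ U cc v (exIn _ U cc v (exFst _ U cc v x)) = exFst _ U cc v x := rfl
    rw [h9, h10]; simp
  have h11 := ex_dec _ U cc v x
  have h12 := congrArg (d _ _ (c0 h (exFst _ U cc)) v w a) h11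
  have h13 := congrArg (e v w a) h11
  rw [map_add, h8] at h12
  rw [map_add] at h13
  rw [h12, h13]
  abel

/-! duality -/
abbrev opN (N : V → V → ℕ) : V → V → ℕ := fun v w => N w v

def D (X : Rep N) : Rep (opN N) where
  X v := Module.Dual ℚ (X.X v)
  f v w a := (X.f w v a).dualMap
  S := X.S
  hS v hv := by have := X.hS v hv; infer_instance

theorem D_dim (X : Rep N) : dim (D X) = dim X := by
  ext v
  rw [dim_apply, dim_apply]
  exact congrArg _ (Subspace.dual_finrank_eq)

theorem dualMap_surj {M P : Type} [AddCommGroup M] [AddCommGroup P] [Module ℚ M] [Module ℚ P]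
    [FiniteDimensional ℚ M] [FiniteDimensional ℚ P] (g : Module.Dual ℚ P →ₗ[ℚ] Module.Dual ℚ M) :
    ∃ h : M →ₗ[ℚ] P, h.dualMap = g := by
  refine ⟨(Module.evalEquiv ℚ P).symm.toLinearMap ∘ₗ g.dualMap ∘ₗ Module.Dual.eval ℚ M, ?_⟩
  ext φ x
  simp

theorem dualMap_inj {M P : Type} [AddCommGroup M] [AddCommGroup P] [Module ℚ M] [Module ℚ P]
    (h g : M →ₗ[ℚ] P) (hg : h.dualMap = g.dualMap) : h = g := by
  ext x
  rw [← sub_eq_zero, ← Module.forall_dual_apply_eq_zero_iff ℚ]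
  intro φ
  have := LinearMap.congr_fun (LinearMap.congr_fun hg φ) x
  simp at this
  rw [map_sub, this, sub_self]

def D0 {X Y : Rep N} (h : C0 X Y) : C0 (D Y) (D X) := fun v => (h v).dualMap
theorem D_d {X Y : Rep N} (h : C0 X Y) (v w a) :
    d (D Y) (D X) (D0 h) v w a = - (d X Y h w v a).dualMap := by
  apply LinearMap.ext
  intro (φ : Module.Dual ℚ (Y.X v))
  apply LinearMap.ext
  intro (x : X.X w)
  change φ (h v (X.f w v a x)) - φ (Y.f w v a (h w x)) =
    - (φ (Y.f w v a (h w x) - h v (X.f w v a x)))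
  rw [map_sub]; abel

theorem D_HomZ {X Y : Rep N} (H : HomZ X Y) : HomZ (D Y) (D X) := by
  rw [HomZ_iff] at *
  intro g hg
  choose h hh using fun v => dualMap_surj (M := X.X v) (P := Y.X v) (g v)
  have e : D0 h = g := funext hh
  have := H h (by
    funext w v a
    apply dualMap_inj
    have := D_d h v w a
    rw [e, hg] at this
    apply LinearMap.ext
    intro (φ : Module.Dual ℚ (Y.X v))
    apply LinearMap.ext
    intro (x : X.X w)
    have h1 : 0 = - φ (d X Y h w v a x) := LinearMap.congr_fun (LinearMap.congr_fun this φ) x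
    change φ (d X Y h w v a x) = φ 0
    rw [map_zero]; linarith)
  rw [← e, this]
  funext v; apply LinearMap.ext
  intro (φ : Module.Dual ℚ (Y.X v))
  apply LinearMap.ext
  intro (x : X.X v)
  change φ 0 = 0
  simp

theorem D_ExtZ {X Y : Rep N} (H : ExtZ X Y) : ExtZ (D Y) (D X) := by
  intro c
  choose e he using fun v w a => dualMap_surj (M := X.X v) (P := Y.X w) (c w v a)
  obtain ⟨h, hh⟩ := H (-e)
  refine ⟨D0 h, ?_⟩
  funext v w a
  rw [D_d, hh, ← he]
  apply LinearMap.ext; intro (φ : Module.Dual ℚ (Y.X v))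
  apply LinearMap.ext; intro (x : X.X w)
  change - φ (- (e w v a x)) = φ (e w v a x)
  simp

open Classical in
theorem E_op (u w : V →₀ ℤ) : E (opN N) u w = E N w u := by
  rw [E_sum u w _ _ subset_rfl subset_rfl, E_sum w u _ _ subset_rfl subset_rfl, Finset.sum_comm]
  refine Finset.sum_congr rfl fun v _ => Finset.sum_congr rfl fun v' _ => ?_
  simp only [opN, eq_comm (a := v) (b := v')]
  ring

end SK


namespace SK
open Module Matrix

/-! ### regular block matrices -/
abbrev Vx (n : ℕ) := Fin n × ℕ
abbrev Mt (n : ℕ) := Matrix (Fin n) (Fin n) ℤ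
noncomputable abbrev lcb {V W : Type} (M : V → W →₀ ℤ) : (V →₀ ℤ) →ₗ[ℤ] (W →₀ ℤ) := Finsupp.linearCombination ℤ M
noncomputable abbrev lcz {V : Type} (M : V → ℤ) : (V →₀ ℤ) →ₗ[ℤ] ℤ := Finsupp.linearCombination ℤ M

variable {n : ℕ}

noncomputable def lam (l : Fin n) : (Vx n →₀ ℤ) →ₗ[ℤ] ℤ := lcz (fun v => if v.1 = l then 1 else 0)

theorem lcz_dot {V : Type} (x y : V →₀ ℤ) : lcz (fun u => y u) x = lcz (fun u => x u) y := by
  classical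
  rw [lcz, lcz, Finsupp.linearCombination_apply, Finsupp.linearCombination_apply,
    Finsupp.sum_of_support_subset x (Finset.subset_union_left : _ ⊆ x.support ∪ y.support) _ (by simp),
    Finsupp.sum_of_support_subset y (Finset.subset_union_right : _ ⊆ x.support ∪ y.support) _ (by simp)]
  refine Finset.sum_congr rfl fun u _ => ?_
  simp [mul_comm]

theorem lcb_apply {V W : Type} (M : V → W →₀ ℤ) (x : V →₀ ℤ) (w : W) :
    lcb M x w = lcz (fun v => M v w) x := by
  rw [lcb, lcz, Finsupp.linearCombination_apply, Finsupp.linearCombination_apply, Finsupp.sum_apply]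
  rfl

theorem lcz_label (g : Fin n → ℤ) (x : Vx n →₀ ℤ) :
    lcz (fun u : Vx n => g u.1) x = ∑ l, lam l x * g l := by
  induction x using Finsupp.induction_linear with
  | zero => simp
  | add a b ha hb => simp [map_add, add_mul, Finset.sum_add_distrib, ha, hb]
  | single a b => simp [lam]

structure Reg (M M' : Vx n → Vx n →₀ ℤ) (r s : Mt n) : Prop where
  tr : ∀ v w, M v w = M' w v
  row : ∀ v l, lam l (M v) = r v.1 l
  col : ∀ w l, lam l (M' w) = s l w.1

theorem Reg.transpose {M M' : Vx n → Vx n →₀ ℤ} {r s : Mt n} (h : Reg M M' r s) :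
    Reg M' M sᵀ rᵀ := ⟨fun v w => (h.tr w v).symm, h.col, h.row⟩

theorem Reg.mul {A A' M M' : Vx n → Vx n →₀ ℤ} {a b r s : Mt n} (hA : Reg A A' a b)
    (hM : Reg M M' r s) :
    Reg (fun v => lcb M (A v)) (fun w => lcb A' (M' w)) (a * r) (b * s) := by
  have aux : ∀ {A A' M M' : Vx n → Vx n →₀ ℤ} {a b r s : Mt n}, Reg A A' a b → Reg M M' r s →
      ∀ v l, lam l (lcb M (A v)) = ∑ j, a v.1 j * r j l := by
    intro A A' M M' a b r s hA hM v l
    have : lam l ∘ₗ lcb M = lcz (fun u : Vx n => r u.1 l) := by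
      ext u; simp [hM.row]
    have h2 := LinearMap.congr_fun this (A v)
    rw [LinearMap.comp_apply] at h2
    rw [h2, lcz_label (fun j => r j l)]
    simp [hA.row]
  refine ⟨?_, ?_, ?_⟩
  · intro v w
    rw [lcb_apply, lcb_apply]
    simp only [hM.tr, ← hA.tr]
    exact lcz_dot _ _
  · intro v l
    rw [aux hA hM]; rfl
  · intro w l
    rw [aux hM.transpose hA.transpose, Matrix.mul_apply]
    refine Finset.sum_congr rfl fun j _ => ?_
    simp [mul_comm]

theorem Reg.sub {A A' M M' : Vx n → Vx n →₀ ℤ} {a b r s : Mt n} (hA : Reg A A' a b)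
    (hM : Reg M M' r s) : Reg (A - M) (A' - M') (a - r) (b - s) :=
  ⟨fun v w => by simp [hA.tr, hM.tr], fun v l => by simp [hA.row, hM.row],
    fun v l => by simp [hA.col, hM.col]⟩

theorem reg_diag (c : Fin n → ℤ) : Reg (fun v : Vx n => Finsupp.single v (c v.1))
    (fun v : Vx n => Finsupp.single v (c v.1)) (diagonal c) (diagonal c) := by
  classical
  have h : ∀ v : Vx n, ∀ l, lam l (Finsupp.single v (c v.1)) = (diagonal c : Mt n) v.1 l := by
    intro v l
    simp [lam, diagonal_apply]
  refine ⟨?_, h, fun w l => ?_⟩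
  · intro v w
    rw [Finsupp.single_apply, Finsupp.single_apply]
    by_cases h : v = w
    · simp [h]
    · simp [h, Ne.symm h]
  · rw [h]; simp only [diagonal_apply, eq_comm (a := w.1)]; split_ifs with h1
    · rw [h1]
    · rfl

theorem lam_sum (l : Fin n) (x : Vx n →₀ ℤ) (F : Finset ℕ) (hF : ∀ p, p ∉ F → x (l, p) = 0) :
    lam l x = ∑ p ∈ F, x (l, p) := by
  classical
  have h1 : lam l x = lcz (fun u : Vx n => (if u.1 = l then 1 else 0)) x := rfl
  rw [h1, lcz, Finsupp.linearCombination_apply,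
    Finsupp.sum_of_support_subset x
    (Finset.subset_union_left : _ ⊆ x.support ∪ F.image (fun p => (l, p)))
    _ (by simp)]
  symm
  have h2 : ∑ p ∈ F, x (l, p) = ∑ u ∈ F.image (fun p => ((l, p) : Vx n)),
      x u • (if u.1 = l then 1 else 0) := by
    rw [Finset.sum_image (by intro a _ b _ h; simpa using h)]; simp
  rw [h2]
  apply Finset.sum_subset Finset.subset_union_right
  rintro ⟨a, p⟩ _ hn
  by_cases ha : a = l
  · subst ha
    have : p ∉ F := fun h => hn (by simp [h])
    simp [hF p this]
  · simp [ha]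

theorem lam_fin (l : Fin n) (x : Vx n →₀ ℤ) : ∃ F : Finset ℕ, ∀ p, p ∉ F → x (l, p) = 0 := by
  classical
  refine ⟨x.support.image Prod.snd, fun p hp => ?_⟩
  by_contra h
  exact hp (Finset.mem_image.2 ⟨(l, p), by simpa using h, rfl⟩)

theorem lam_nonneg (l : Fin n) (x : Vx n →₀ ℤ) (h : ∀ p, 0 ≤ x (l, p)) : 0 ≤ lam l x := by
  obtain ⟨F, hF⟩ := lam_fin l x
  rw [lam_sum l x F hF]
  exact Finset.sum_nonneg fun p _ => h p

theorem lam_pos (l : Fin n) (x : Vx n →₀ ℤ) (h : ∀ p, 0 ≤ x (l, p)) (p : ℕ) (hp : x (l, p) ≠ 0) :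
    0 < lam l x := by
  obtain ⟨F, hF⟩ := lam_fin l x
  rw [lam_sum l x F hF]
  refine Finset.sum_pos' (fun p _ => h p) ⟨p, ?_, lt_of_le_of_ne (h p) (Ne.symm hp)⟩
  by_contra hh
  exact hp (hF p hh)

theorem lam_zero (l : Fin n) (x : Vx n →₀ ℤ) (h : ∀ p, x (l, p) = 0) : lam l x = 0 := by
  rw [lam_sum l x ∅ (fun p _ => h p)]; simp

/-- block sign lemma -/
theorem Reg.block {M M' : Vx n → Vx n →₀ ℤ} {r s : Mt n} (h : Reg M M' r s) (j k : Fin n)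
    (hn : ∀ p q, 0 ≤ M (j, p) (k, q)) :
    (r j k = 0 ∧ s j k = 0 ∧ ∀ p q, M (j, p) (k, q) = 0) ∨
    (0 < r j k ∧ 0 < s j k ∧ (∀ p, ∃ q, M (j, p) (k, q) ≠ 0) ∧ (∀ q, ∃ p, M (j, p) (k, q) ≠ 0)) := by
  have hn' : ∀ p q, 0 ≤ M' (k, q) (j, p) := fun p q => h.tr _ _ ▸ hn p q
  by_cases hz : ∀ p q, M (j, p) (k, q) = 0
  · left
    have h1 := lam_zero k (M (j, 0)) (hz 0)
    have h2 := lam_zero j (M' (k, 0)) (fun p => by rw [← h.tr]; exact hz p 0)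
    rw [h.row] at h1
    rw [h.col] at h2
    exact ⟨h1, h2, hz⟩
  · right
    push Not at hz
    obtain ⟨p, q, hpq⟩ := hz
    have h1 := lam_pos k (M (j, p)) (hn p) q hpq
    have h2 := lam_pos j (M' (k, q)) (fun p => hn' p q) p (by rw [← h.tr]; exact hpq)
    rw [h.row] at h1
    rw [h.col] at h2
    refine ⟨h1, h2, fun p => ?_, fun q => ?_⟩
    · by_contra hc
      push Not at hc
      have := lam_zero k (M (j, p)) hc
      rw [h.row] at this
      simp at h1 this
      omega
    · by_contra hc
      push Not at hc
      have := lam_zero j (M' (k, q)) (fun p => by rw [← h.tr]; exact hc p)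
      rw [h.col] at this
      simp at h2 this
      omega

theorem Reg.neg {M M' : Vx n → Vx n →₀ ℤ} {r s : Mt n} (hM : Reg M M' r s) :
    Reg (-M) (-M') (-r) (-s) :=
  ⟨fun v w => by simp [hM.tr], fun v l => by simp [hM.row], fun v l => by simp [hM.col]⟩

def RegQ (N : Vx n → Vx n → ℕ) (P Qc : Mt n) : Prop :=
  ∃ M M', (∀ v w, (M v w : ℤ) = N v w) ∧ Reg M M' P Qc

theorem RegQ.op {N : Vx n → Vx n → ℕ} {P Qc : Mt n} (h : RegQ N P Qc) :
    RegQ (opN N) Qcᵀ Pᵀ := by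
  obtain ⟨M, M', h1, h2⟩ := h
  exact ⟨M', M, fun v w => by rw [← h2.tr, h1], h2.transpose⟩

/-- the Gram matrix is regular -/
theorem gram_reg {N : Vx n → Vx n → ℕ} {P Qc : Mt n} (h : RegQ N P Qc)
    {β β' : Vx n → Vx n →₀ ℤ} {R S : Mt n} (hβ : Reg β β' R S) :
    ∃ Φ : (Vx n →₀ ℤ) →ₗ[ℤ] (Vx n →₀ ℤ), (∀ u w, Φ u w = E N u (β w)) ∧ 
    ∃ G', Reg (fun v => Φ (β v)) G' (R * (1 - P) * Sᵀ) (S * (1 - Qc) * Rᵀ) := by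
  classical
  obtain ⟨M, M', h1, h2⟩ := h
  have hK : Reg ((fun v : Vx n => Finsupp.single v (1 : ℤ)) - M)
      ((fun v : Vx n => Finsupp.single v (1 : ℤ)) - M') (1 - P) (1 - Qc) := by
    have := (reg_diag (n := n) (fun _ => 1)).sub h2
    rwa [diagonal_one] at this
  refine ⟨lcb β' ∘ₗ lcb ((fun v : Vx n => Finsupp.single v (1 : ℤ)) - M), ?_, _,
    (hβ.mul hK).mul hβ.transpose⟩
  intro u w
  induction u using Finsupp.induction_linear with
  | zero => simp
  | add a b ha hb => simp only [map_add, Finsupp.add_apply, LinearMap.add_apply, ha, hb]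
  | single a b =>
    rw [LinearMap.comp_apply, lcb, Finsupp.linearCombination_single, map_smul, Finsupp.smul_apply,
      lcb_apply, E, Finsupp.linearCombination_single, LinearMap.smul_apply]
    congr 1
    simp only [← hβ.tr]
    rw [lcz_dot]
    congr 2
    funext x
    simp [Finsupp.single_apply, h1]

theorem homZ_of_disj {V : Type} {N : V → V → ℕ} {X Y : Rep N} (h : ∀ v, dim X v = 0 ∨ dim Y v = 0) :
    HomZ X Y := by
  rw [HomZ_iff]
  intro g _
  funext v; ext x
  rcases h v with h | h
  · rw [dim_apply, Nat.cast_eq_zero, Module.finrank_zero_iff] at h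
    rw [Subsingleton.elim x 0]; simp
  · rw [dim_apply, Nat.cast_eq_zero, Module.finrank_zero_iff] at h
    exact Subsingleton.elim _ _

theorem homext_zero {V : Type} {N : V → V → ℕ} {X Y : Rep N} (h : HomZ X Y) (h' : ExtZ X Y) :
    E N (dim X) (dim Y) = 0 := by
  rw [← euler, (homZ_iff _ _).1 h, (extZ_iff _ _).1 h']; simp

theorem ext_of_hom {V : Type} {N : V → V → ℕ} {X Y : Rep N} (h : HomZ X Y)
    (h' : E N (dim X) (dim Y) = 0) : ExtZ X Y := by
  rw [← euler, (homZ_iff _ _).1 h] at h'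
  rw [extZ_iff]; simpa using h'

theorem hom_of_ext {V : Type} {N : V → V → ℕ} {X Y : Rep N} (h : ExtZ X Y)
    (h' : E N (dim X) (dim Y) = 0) : HomZ X Y := by
  rw [← euler, (extZ_iff _ _).1 h] at h'
  rw [homZ_iff]; simpa using h'

/-- total dimension -/
noncomputable def tot : (Vx n →₀ ℤ) →ₗ[ℤ] ℤ := ∑ l, lam l

theorem tot_nonneg {N : Vx n → Vx n → ℕ} (X : Rep N) : 0 ≤ tot (dim X) := by
  rw [tot, LinearMap.sum_apply]
  exact Finset.sum_nonneg fun l _ => lam_nonneg l _ fun p => by rw [dim_apply]; positivity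

theorem tot_pos {N : Vx n → Vx n → ℕ} (X : Rep N) (h : dim X ≠ 0) : 0 < tot (dim X) := by
  rw [tot, LinearMap.sum_apply]
  obtain ⟨⟨l, p⟩, hv⟩ := Finsupp.ne_iff.1 h
  have h0 : ∀ l p, 0 ≤ dim X (l, p) := fun l p => by rw [dim_apply]; positivity
  exact Finset.sum_pos' (fun l _ => lam_nonneg l _ (h0 l))
    ⟨l, Finset.mem_univ _, lam_pos l _ (h0 l) p hv⟩

end SK


namespace SK
open Module Matrix

section constr
variable {V : Type} {N : V → V → ℕ}

structure Fam (κ : ℕ → Rep N) : Prop where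
  hk : ∀ p q, p ≠ q → HomZ (κ p) (κ q)
  he : ∀ p q, ExtZ (κ p) (κ q)
  h1 : ∀ p, E N (dim (κ p)) (dim (κ p)) = 1

theorem Fam.E_sum {κ : ℕ → Rep N} (h : Fam κ) (F : Finset ℕ) (c : ℕ → ℤ) (q : ℕ)
    (hq : q ∉ F → c q = 0) :
    E N (∑ p ∈ F, c p • dim (κ p)) (dim (κ q)) = c q := by
  classical
  rw [map_sum, LinearMap.sum_apply]
  have : ∀ p ∈ F, (E N (c p • dim (κ p))) (dim (κ q)) = if p = q then c q else 0 := by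
    intro p _
    rw [map_smul, LinearMap.smul_apply]
    split_ifs with hpq
    · subst hpq; rw [h.h1]; simp
    · rw [homext_zero (h.hk p q hpq) (h.he p q)]; simp
  rw [Finset.sum_congr rfl this, Finset.sum_ite_eq']
  split_ifs with h'
  · rfl
  · exact (hq h').symm

theorem E_sum_l {κ : ℕ → Rep N} (F : Finset ℕ) (c : ℕ → ℤ) (u : V →₀ ℤ)
    (hq : ∀ p, E N (dim (κ p)) u = 0) :
    E N (∑ p ∈ F, c p • dim (κ p)) u = 0 := by
  rw [map_sum, LinearMap.sum_apply]
  exact Finset.sum_eq_zero fun p _ => by rw [map_smul, LinearMap.smul_apply, hq]; simp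

theorem E_sum_r {κ : ℕ → Rep N} (F : Finset ℕ) (c : ℕ → ℤ) (u : V →₀ ℤ)
    (hq : ∀ p, E N u (dim (κ p)) = 0) :
    E N u (∑ p ∈ F, c p • dim (κ p)) = 0 := by
  rw [map_sum]
  exact Finset.sum_eq_zero fun p _ => by rw [map_smul, hq]; simp

structure PropP (κ : ℕ → Rep N) (U U' : Rep N) : Prop where
  hl : ∀ W, HomZ U W → (∀ p, HomZ (κ p) W) → HomZ U' W
  el : ∀ W, ExtZ U W → (∀ p, ExtZ (κ p) W) → ExtZ U' W
  hr : ∀ W, HomZ W U → (∀ p, HomZ W (κ p)) → HomZ W U'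
  er : ∀ W, ExtZ W U → (∀ p, ExtZ W (κ p)) → ExtZ W U'
  hκ : ∀ p, HomZ U' (κ p)
  eκ : ∀ p, ExtZ U' (κ p)
  e1 : E N (dim U') (dim U') = 1

theorem mkP {κ : ℕ → Rep N} (hf : Fam κ) (U : Rep N) (U1 : E N (dim U) (dim U) = 1)
    (hUκ : ∀ p, HomZ U (κ p)) (hκU : ∀ p, HomZ (κ p) U) (eκU : ∀ p, ExtZ (κ p) U)
    (F : Finset ℕ) (hF : ∀ p, p ∉ F → ExtZ U (κ p)) :
    ∃ U', PropP κ U U' ∧ dim U' = dim U + ∑ p ∈ F, (ext U (κ p) : ℤ) • dim (κ p) := by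
  obtain ⟨T, U', hs, hE, hT, -, hd⟩ := UE U κ hf.he F hF
  obtain ⟨t1, t2, t3, t4⟩ := hT
  have hdim : dim U' = dim U + ∑ p ∈ F, (ext U (κ p) : ℤ) • dim (κ p) := by
    rw [hs.dim, hd, add_comm]
  have hE0 : ∀ q, E N (dim U') (dim (κ q)) = 0 := by
    intro q
    rw [hdim, map_add, LinearMap.add_apply, hf.E_sum F (fun p => (ext U (κ p) : ℤ)) q, ← euler,
      (homZ_iff _ _).1 (hUκ q)]
    · simp
    · intro h; simp [(extZ_iff _ _).1 (hF q h)]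
  refine ⟨U', ⟨?_, ?_, ?_, ?_, fun p => hom_of_ext (hE p) (hE0 p), hE, ?_⟩, hdim⟩
  · exact fun W h1 h2 => (hs.con W).injB h1 (t3 W h2)
  · exact fun W h1 h2 => (hs.con W).surjB h1 (t4 W h2)
  · exact fun W h1 h2 => (hs.cov W).injB (t1 W h2) h1
  · exact fun W h1 h2 => (hs.cov W).surjB (t2 W h2) h1
  · have e1 : E N (dim U') (dim U') = E N (dim U') (dim U) := by
      conv_lhs => rw [hdim]
      rw [map_add, ← hdim, E_sum_r F _ _ hE0, add_zero]
    rw [e1, hdim, map_add, LinearMap.add_apply, U1,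
      E_sum_l F _ _ (fun p => homext_zero (hκU p) (eκU p)), add_zero]

structure PropM (κ : ℕ → Rep N) (y C : Rep N) : Prop where
  hl : ∀ W, (∀ p, HomZ (κ p) W) → HomZ C W
  el : ∀ W, HomZ y W → (∀ p, ExtZ (κ p) W) → ExtZ C W
  hr : ∀ W, (∀ p, HomZ W (κ p)) → ExtZ W y → HomZ W C
  er : ∀ W, (∀ p, ExtZ W (κ p)) → ExtZ W C
  hκ : ∀ p, HomZ C (κ p)
  eκ : ∀ p, ExtZ C (κ p)
  e1 : E N (dim C) (dim C) = 1
  ey : ∀ W, (∀ p, ExtZ (κ p) W) → ExtZ y W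

structure PropE (κ : ℕ → Rep N) (y K : Rep N) : Prop where
  hl : ∀ W, HomZ y W → (∀ p, ExtZ (κ p) W) → HomZ K W
  el : ∀ W, ExtZ y W → ExtZ K W
  hr : ∀ W, HomZ W y → HomZ W K
  er : ∀ W, ExtZ W y → (∀ p, HomZ W (κ p)) → ExtZ W K
  hκ : ∀ p, HomZ K (κ p)
  e1 : E N (dim K) (dim K) = 1

theorem mkN {κ : ℕ → Rep N} (hf : Fam κ) (y : Rep N) (y1 : E N (dim y) (dim y) = 1)
    (eyy : ExtZ y y) (hκy : ∀ p, HomZ (κ p) y) (eκy : ∀ p, ExtZ (κ p) y) (eyκ : ∀ p, ExtZ y (κ p))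
    (F : Finset ℕ) (hF : ∀ p, p ∉ F → HomZ y (κ p)) :
    ∃ T Z : Rep N, dim T = ∑ p ∈ F, (hom y (κ p) : ℤ) • dim (κ p) ∧
      ((dim Z ≠ 0 ∧ dim Z = dim T - dim y ∧ PropM κ y Z) ∨
       (dim Z = dim y - dim T ∧ PropE κ y Z ∧ (∀ p, ExtZ Z (κ p)) ∧
         ∀ p, ¬ HomZ y (κ p) → ∀ W, ExtZ W y → ExtZ W (κ p))) := by
  obtain ⟨T, Z, hT, hT', hd, hc⟩ := UM y κ hf.hk (fun p => hf.he p p) hf.h1 eκy eyy y1 F hF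
  obtain ⟨t1, t2, t3, t4⟩ := hT
  have hTκ : ∀ q, E N (dim T) (dim (κ q)) = hom y (κ q) := by
    intro q
    rw [hd, hf.E_sum F (fun p => (hom y (κ p) : ℤ)) q]
    intro h; simp [(homZ_iff _ _).1 (hF q h)]
  have hyκ : ∀ q, E N (dim y) (dim (κ q)) = hom y (κ q) := by
    intro q; rw [← euler, (extZ_iff _ _).1 (eyκ q)]; simp
  have hTy : E N (dim T) (dim y) = 0 := by
    rw [hd]; exact E_sum_l F _ _ (fun p => homext_zero (hκy p) (eκy p))
  refine ⟨T, Z, hd, ?_⟩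
  rcases hc with ⟨hs, hZ⟩ | hs
  · left
    have hdim : dim Z = dim T - dim y := by rw [hs.dim]; simp
    have hE0 : ∀ q, E N (dim Z) (dim (κ q)) = 0 := by
      intro q; rw [hdim, map_sub, LinearMap.sub_apply, hTκ, hyκ, sub_self]
    have hZ1 : E N (dim Z) (dim Z) = 1 := by
      have e1 : E N (dim Z) (dim Z) = - E N (dim Z) (dim y) := by
        conv_lhs => rw [hdim]
        rw [map_sub, ← hdim]
        conv_lhs => rw [hd]
        rw [E_sum_r F _ _ hE0, zero_sub]
      rw [e1, hdim, map_sub, LinearMap.sub_apply, hTy, y1]; simp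
    refine ⟨?_, hdim, ?_, ?_, ?_, ?_, hZ, fun q => ext_of_hom (hZ q) (hE0 q), hZ1, ?_⟩
    · intro h; rw [h] at hZ1; simp at hZ1
    · exact fun W h1 => (hs.con W).injA (t3 W h1)
    · exact fun W h1 h2 => (hs.con W).surjA (t4 W h2) h1
    · exact fun W h1 h2 => (hs.cov W).injD (t1 W h1) h2
    · exact fun W h1 => (hs.cov W).surjD (t2 W h1)
    · exact fun W h1 => (hs.con W).surjD (t4 W h1)
  · right
    have hdim : dim Z = dim y - dim T := by rw [hs.dim]; simp
    have hE0 : ∀ q, E N (dim Z) (dim (κ q)) = 0 := by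
      intro q; rw [hdim, map_sub, LinearMap.sub_apply, hTκ, hyκ, sub_self]
    have eZ : ∀ q, ExtZ Z (κ q) := fun q => (hs.con _).surjD (eyκ q)
    have hZ1 : E N (dim Z) (dim Z) = 1 := by
      have e1 : E N (dim Z) (dim Z) = E N (dim Z) (dim y) := by
        conv_lhs => rw [hdim]
        rw [map_sub, ← hdim]
        conv_lhs => rw [hd]
        rw [E_sum_r F _ _ hE0, sub_zero]
      rw [e1, hdim, map_sub, LinearMap.sub_apply, hTy, y1]; simp
    refine ⟨hdim, ⟨?_, ?_, ?_, ?_, fun q => hom_of_ext (eZ q) (hE0 q), hZ1⟩, eZ,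
      fun p hp W hW => hT' p hp W ((hs.cov W).surjD hW)⟩
    · exact fun W h1 h2 => (hs.con W).injD h1 (t4 W h2)
    · exact fun W h1 => (hs.con W).surjD h1
    · exact fun W h1 => (hs.cov W).injA h1
    · exact fun W h1 h2 => (hs.cov W).surjA h1 (t1 W h2)

/-- weak trichotomy, without the assumption `ExtZ y κ` -/
theorem mkW {κ : ℕ → Rep N} (hf : Fam κ) (y : Rep N) (y1 : E N (dim y) (dim y) = 1)
    (eyy : ExtZ y y) (eκy : ∀ p, ExtZ (κ p) y)
    (F : Finset ℕ) (hF : ∀ p, p ∉ F → HomZ y (κ p)) :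
    ∃ Z : Rep N, ((dim Z = (∑ p ∈ F, (hom y (κ p) : ℤ) • dim (κ p)) - dim y ∧ ∀ p, ExtZ y (κ p)) ∨
       (dim Z = dim y - ∑ p ∈ F, (hom y (κ p) : ℤ) • dim (κ p) ∧
        ∀ p, ¬ HomZ y (κ p) → ∀ W, ExtZ W y → ExtZ W (κ p))) := by
  obtain ⟨T, Z, hT, hT', hd, hc⟩ := UM y κ hf.hk (fun p => hf.he p p) hf.h1 eκy eyy y1 F hF
  obtain ⟨t1, t2, t3, t4⟩ := hT
  refine ⟨Z, ?_⟩
  rw [← hd]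
  rcases hc with ⟨hs, hZ⟩ | hs
  · left
    exact ⟨by rw [hs.dim]; simp, fun p => (hs.con _).surjD (t4 _ fun q => hf.he q p)⟩
  · right
    exact ⟨by rw [hs.dim]; simp, fun p hp W hW => hT' p hp W ((hs.cov W).surjD hW)⟩

end constr
end SK


namespace SK
open Module Matrix

variable {n : ℕ}

structure State (N : Vx n → Vx n → ℕ) (P Qc B : Mt n) where
  X : Vx n → Rep N
  ε : Fin n → ℤ
  hε : ∀ i, ε i = 1 ∨ ε i = -1
  ρ : Fin n → ℕ
  ordH : ∀ v w : Vx n, v ≠ w → ρ v.1 ≤ ρ w.1 → HomZ (X v) (X w)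
  ordE : ∀ v w : Vx n, ρ v.1 ≤ ρ w.1 → ExtZ (X v) (X w)
  e1 : ∀ v, E N (dim (X v)) (dim (X v)) = 1
  orth : ∀ v w : Vx n, ε v.1 = ε w.1 → v ≠ w → HomZ (X v) (X w)
  sgn : ∀ i j, ε i = 1 → ε j = -1 → ρ i < ρ j
  rq : RegQ N P Qc
  β' : Vx n → Vx n →₀ ℤ
  R : Mt n
  S : Mt n
  reg : Reg (fun v => ε v.1 • dim (X v)) β' R S
  mat : B = R * (P - Qcᵀ) * Sᵀ

variable {N : Vx n → Vx n → ℕ} {P Qc B : Mt n}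

namespace State
variable (s : State N P Qc B)

theorem fam (k : Fin n) : Fam (fun p => s.X (k, p)) where
  hk p q h := s.ordH _ _ (by simpa using h) le_rfl
  he p q := s.ordE _ _ le_rfl
  h1 p := s.e1 _

noncomputable def β (v : Vx n) : Vx n →₀ ℤ := s.ε v.1 • dim (s.X v)

noncomputable def Φ : (Vx n →₀ ℤ) →ₗ[ℤ] (Vx n →₀ ℤ) := (gram_reg s.rq s.reg).choose
theorem Φ_apply (u w) : s.Φ u w = E N u (s.β w) := (gram_reg s.rq s.reg).choose_spec.1 u w
def gr : Mt n := s.R * (1 - P) * s.Sᵀ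
def gc : Mt n := s.S * (1 - Qc) * s.Rᵀ
noncomputable def G (v : Vx n) : Vx n →₀ ℤ := s.Φ (s.β v)
noncomputable def G' : Vx n → Vx n →₀ ℤ := (gram_reg s.rq s.reg).choose_spec.2.choose
theorem regG : Reg s.G s.G' s.gr s.gc := (gram_reg s.rq s.reg).choose_spec.2.choose_spec

theorem G_apply (v w : Vx n) :
    s.G v w = s.ε v.1 * s.ε w.1 * E N (dim (s.X v)) (dim (s.X w)) := by
  rw [G, Φ_apply, β, β, map_smul, map_smul, LinearMap.smul_apply]
  simp; ring

theorem B_eq (i j : Fin n) : B i j = s.gc j i - s.gr i j := by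
  have : B = s.gcᵀ - s.gr := by
    rw [gc, gr, transpose_mul, transpose_mul, transpose_transpose, transpose_sub, transpose_one,
      ← Matrix.mul_assoc, ← Matrix.sub_mul, ← Matrix.mul_sub]
    refine s.mat.trans ?_
    congr 2
    abel
  exact congrFun (congrFun this i) j

theorem fin (U : Rep N) (k : Fin n) : ∃ F : Finset ℕ, ∀ p, p ∉ F →
    HomZ U (s.X (k, p)) ∧ ExtZ U (s.X (k, p)) := by
  classical
  refine ⟨((dim U).support.biUnion fun v => (s.β' v).support.image Prod.snd) ∪
    (s.Φ (dim U)).support.image Prod.snd, fun p hp => ?_⟩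
  rw [Finset.mem_union, not_or] at hp
  obtain ⟨h1, h2⟩ := hp
  have hh : s.ε k ≠ 0 := by rcases s.hε k with h | h <;> simp [h]
  have hH : HomZ U (s.X (k, p)) := by
    refine homZ_of_disj fun v => ?_
    by_contra hc
    push Not at hc
    apply h1
    refine Finset.mem_biUnion.2 ⟨v, by simpa using hc.1, Finset.mem_image.2 ⟨(k, p), ?_, rfl⟩⟩
    rw [Finsupp.mem_support_iff, ← s.reg.tr]
    simp only [Finsupp.smul_apply, smul_eq_mul]
    exact mul_ne_zero hh hc.2
  refine ⟨hH, ext_of_hom hH ?_⟩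
  by_contra hc
  apply h2
  refine Finset.mem_image.2 ⟨(k, p), ?_, rfl⟩
  rw [Finsupp.mem_support_iff, Φ_apply, β, map_smul]
  exact mul_ne_zero hh hc

noncomputable def sz (j : Fin n) : ℤ := tot (dim (s.X (j, 0)))

theorem tot_dim (j p) : tot (dim (s.X (j, p))) = s.sz j := by
  have h : ∀ q, s.ε j * tot (dim (s.X (j, q))) = ∑ l, s.R j l := by
    intro q
    have : s.ε j * tot (dim (s.X (j, q))) = tot (s.β (j, q)) := by
      rw [β, map_smul]; rfl
    rw [this, tot, LinearMap.sum_apply]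
    exact Finset.sum_congr rfl fun l _ => s.reg.row (j, q) l
  have hh : s.ε j ≠ 0 := by rcases s.hε j with h | h <;> simp [h]
  exact mul_left_cancel₀ hh ((h p).trans (h 0).symm)

theorem sz_pos (j) : 0 < s.sz j := by
  apply tot_pos
  intro h
  have := s.e1 (j, 0)
  rw [h] at this; simp at this

theorem gr_sum (j p k) (F : Finset ℕ) (hF : ∀ q, q ∉ F → s.G (j, p) (k, q) = 0) :
    s.gr j k = ∑ q ∈ F, s.G (j, p) (k, q) := by
  rw [← lam_sum k _ F hF, s.regG.row]

theorem G_neg (j k p q) (hj : s.ε j = -1) (hk : s.ε k = 1) :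
    s.G (j, p) (k, q) = ext (s.X (j, p)) (s.X (k, q)) - hom (s.X (j, p)) (s.X (k, q)) := by
  rw [G_apply, ← euler]; simp [hj, hk]

theorem LCp (j k : Fin n) (hj : s.ε j = -1) (hk : s.ε k = 1) (p : ℕ) :
    (s.sz j ≤ (- s.gr j k) * s.sz k ∧ ∀ q, ExtZ (s.X (j, p)) (s.X (k, q))) ∨
    ((∀ q, ¬ HomZ (s.X (j, p)) (s.X (k, q)) → ∀ p', ExtZ (s.X (j, p')) (s.X (k, q))) ∧
     ∀ q, ¬ ExtZ (s.X (j, p)) (s.X (k, q)) → (- s.gr j k + 1) * s.sz k ≤ s.sz j) := by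
  obtain ⟨F, hF⟩ := s.fin (s.X (j, p)) k
  have hlt := s.sgn k j hk hj
  obtain ⟨Z, hZ⟩ := mkW (s.fam k) (s.X (j, p)) (s.e1 _) (s.ordE _ _ le_rfl)
    (fun q => s.ordE _ _ hlt.le) F (fun q hq => (hF q hq).1)
  have hgr := s.gr_sum j p k F (by
    intro q hq
    rw [G_apply, homext_zero (hF q hq).1 (hF q hq).2]; simp)
  simp only [s.G_neg j k _ _ hj hk, Finset.sum_sub_distrib] at hgr
  have htot : tot (∑ q ∈ F, (hom (s.X (j, p)) (s.X (k, q)) : ℤ) • dim (s.X (k, q))) =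
      (∑ q ∈ F, (hom (s.X (j, p)) (s.X (k, q)) : ℤ)) * s.sz k := by
    rw [map_sum, Finset.sum_mul]
    exact Finset.sum_congr rfl fun q _ => by rw [map_smul, tot_dim]; rfl
  have hZ0 := tot_nonneg Z
  have hk0 := s.sz_pos k
  rcases hZ with ⟨hd, he⟩ | ⟨hd, he⟩
  · left
    refine ⟨?_, he⟩
    rw [hd, map_sub, htot, tot_dim] at hZ0
    have : ∑ q ∈ F, (ext (s.X (j, p)) (s.X (k, q)) : ℤ) = 0 :=
      Finset.sum_eq_zero fun q _ => by rw [(extZ_iff _ _).1 (he q)]; simp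
    rw [this] at hgr
    rw [hgr]; linarith
  · right
    refine ⟨fun q hq p' => he q hq _ (s.ordE _ _ le_rfl), fun q hq => ?_⟩
    rw [hd, map_sub, htot, tot_dim] at hZ0
    have hqF : q ∈ F := by by_contra h; exact hq (hF q h).2
    have h1 : (1 : ℤ) ≤ ext (s.X (j, p)) (s.X (k, q)) := by
      rw [extZ_iff] at hq; omega
    have h2 : (ext (s.X (j, p)) (s.X (k, q)) : ℤ) ≤ ∑ q ∈ F, (ext (s.X (j, p)) (s.X (k, q)) : ℤ) :=
      Finset.single_le_sum (f := fun q => (ext (s.X (j, p)) (s.X (k, q)) : ℤ))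
        (fun i _ => by positivity) hqF
    nlinarith

theorem LC (j k : Fin n) (hj : s.ε j = -1) (hk : s.ε k = 1) :
    (∀ p q, HomZ (s.X (j, p)) (s.X (k, q))) ∨ (∀ p q, ExtZ (s.X (j, p)) (s.X (k, q))) := by
  by_contra hc
  rw [not_or] at hc
  push Not at hc
  obtain ⟨⟨p0, q0, h0⟩, p1, q1, h1⟩ := hc
  have hk0 := s.sz_pos k
  have big : (- s.gr j k + 1) * s.sz k ≤ s.sz j := by
    rcases s.LCp j k hj hk p1 with h | h
    · exact absurd (h.2 q1) h1
    · exact h.2 q1 h1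
  have ep : ∀ p q, ¬ HomZ (s.X (j, p)) (s.X (k, q)) → ∀ p', ExtZ (s.X (j, p')) (s.X (k, q)) := by
    intro p
    rcases s.LCp j k hj hk p with h | h
    · exfalso; have := h.1; linarith
    · exact h.1
  have e0 := ep p0 q0 h0
  have hneg : 0 < lam j (- s.G' (k, q0)) := by
    have key : ∀ p, (- s.G' (k, q0)) (j, p) = hom (s.X (j, p)) (s.X (k, q0)) := by
      intro p
      rw [Finsupp.neg_apply, ← s.regG.tr, s.G_neg j k _ _ hj hk, (extZ_iff _ _).1 (e0 p)]; simp
    refine lam_pos j _ (fun p => ?_) p0 ?_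
    · rw [key]; positivity
    · rw [key]; rw [homZ_iff] at h0; exact_mod_cast h0
  rw [map_neg, s.regG.col] at hneg
  have : ∃ p3, s.G (j, p3) (k, q1) < 0 := by
    by_contra hc
    push Not at hc
    have := lam_nonneg j (s.G' (k, q1)) (fun p => by rw [← s.regG.tr]; exact hc p)
    rw [s.regG.col] at this
    simp only at this hneg
    linarith
  obtain ⟨p3, h3⟩ := this
  refine h1 (ep p3 q1 (fun h => ?_) p1)
  rw [s.G_neg j k _ _ hj hk, (homZ_iff _ _).1 h] at h3
  simp at h3
  omega

theorem coh (j k : Fin n) (hjk : j ≠ k) :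
    (∀ p q, HomZ (s.X (j, p)) (s.X (k, q))) ∨ (∀ p q, ExtZ (s.X (j, p)) (s.X (k, q))) := by
  have hne : ∀ p q, ((j, p) : Vx n) ≠ (k, q) := fun p q h => hjk (congrArg Prod.fst h)
  by_cases he : s.ε j = s.ε k
  · exact Or.inl fun p q => s.orth _ _ he (hne p q)
  rcases s.hε j with h1 | h1 <;> rcases s.hε k with h2 | h2
  · exact absurd (h1.trans h2.symm) he
  · exact Or.inl fun p q => s.ordH _ _ (hne p q) (s.sgn j k h1 h2).le
  · exact s.LC j k h1 h2
  · exact absurd (h1.trans h2.symm) he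

theorem eps_mul (j k) : s.ε j * s.ε k = 1 ∨ s.ε j * s.ε k = -1 := by
  rcases s.hε j with h1 | h1 <;> rcases s.hε k with h2 | h2 <;> simp [h1, h2]

theorem block (j k : Fin n) (hjk : j ≠ k) :
    (s.gr j k = 0 ∧ s.gc j k = 0 ∧ ∀ p q, s.G (j, p) (k, q) = 0) ∨
    (((0 < s.gr j k ∧ 0 < s.gc j k) ∨ (s.gr j k < 0 ∧ s.gc j k < 0)) ∧
      (∀ p, ∃ q, s.G (j, p) (k, q) ≠ 0) ∧ (∀ q, ∃ p, s.G (j, p) (k, q) ≠ 0)) := by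
  have hs : (∀ p q, 0 ≤ s.G (j, p) (k, q)) ∨ (∀ p q, 0 ≤ (- s.G) (j, p) (k, q)) := by
    rcases s.coh j k hjk with h | h
    · have : ∀ p q, E N (dim (s.X (j, p))) (dim (s.X (k, q))) ≤ 0 := fun p q => by
        rw [← euler, (homZ_iff _ _).1 (h p q)]; simp
      rcases s.eps_mul j k with he | he
      · right; intro p q; have := this p q
        simp only [Pi.neg_apply, Finsupp.neg_apply, G_apply, he]; linarith
      · left; intro p q; have := this p q
        simp only [G_apply, he]; linarith
    · have : ∀ p q, 0 ≤ E N (dim (s.X (j, p))) (dim (s.X (k, q))) := fun p q => by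
        rw [← euler, (extZ_iff _ _).1 (h p q)]; simp
      rcases s.eps_mul j k with he | he
      · left; intro p q; have := this p q
        simp only [G_apply, he]; linarith
      · right; intro p q; have := this p q
        simp only [Pi.neg_apply, Finsupp.neg_apply, G_apply, he]; linarith
  rcases hs with h | h
  · rcases s.regG.block j k h with h | ⟨h1, h2, h3⟩
    · exact Or.inl h
    · exact Or.inr ⟨Or.inl ⟨h1, h2⟩, h3⟩
  · rcases s.regG.neg.block j k h with ⟨h1, h2, h3⟩ | ⟨h1, h2, h3⟩
    · left; simp at h1 h2 h3; exact ⟨h1, h2, h3⟩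
    · right; simp at h1 h2 h3; exact ⟨Or.inr ⟨h1, h2⟩, h3⟩

theorem g_diag (i : Fin n) : s.gr i i = 1 ∧ s.gc i i = 1 := by
  have h0 : ∀ p q, p ≠ q → s.G (i, p) (i, q) = 0 := fun p q h => by
    rw [G_apply, homext_zero ((s.fam i).hk p q h) ((s.fam i).he p q)]; simp
  have h1 : ∀ p, s.G (i, p) (i, p) = 1 := fun p => by
    rw [G_apply, s.e1]; rcases s.hε i with h | h <;> simp [h]
  constructor
  · rw [← s.regG.row (i, 0) i, lam_sum i _ {0} (fun p hp => h0 0 p (by simpa [eq_comm] using hp))]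
    simp [h1]
  · rw [← s.regG.col (i, 0) i, lam_sum i _ {0}
      (fun p hp => by rw [← s.regG.tr]; exact h0 p 0 (by simpa using hp))]
    simp [← s.regG.tr, h1]

theorem g_ord (i j : Fin n) (hij : i ≠ j) (h : s.ρ i ≤ s.ρ j) : s.gr i j = 0 ∧ s.gc i j = 0 := by
  have h0 : ∀ p q, s.G (i, p) (j, q) = 0 := fun p q => by
    rw [G_apply, homext_zero (s.ordH _ _ (fun h => hij (congrArg Prod.fst h)) h)
      (s.ordE _ _ h)]; simp
  constructor
  · rw [← s.regG.row (i, 0) j]; exact lam_zero _ _ (h0 0)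
  · rw [← s.regG.col (j, 0) i]; exact lam_zero _ _ (fun p => by rw [← s.regG.tr]; exact h0 p 0)

theorem sss (s : State N P Qc B) : ∀ i j, (B i j = 0 ∧ B j i = 0) ∨ B i j * B j i < 0 := by
  have key : ∀ i j, i ≠ j → s.ρ i ≤ s.ρ j → (B i j = 0 ∧ B j i = 0) ∨ B i j * B j i < 0 := by
    intro i j hij h
    obtain ⟨h1, h2⟩ := s.g_ord i j hij h
    rw [s.B_eq i j, s.B_eq j i, h1, h2]
    rcases s.block j i hij.symm with ⟨h3, h4, -⟩ | ⟨⟨h3, h4⟩ | ⟨h3, h4⟩, -⟩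
    · left; simp [h3, h4]
    · right; nlinarith
    · right; nlinarith
  intro i j
  by_cases hij : i = j
  · subst hij; left; rw [s.B_eq, (s.g_diag i).1, (s.g_diag i).2]; simp
  rcases le_total (s.ρ i) (s.ρ j) with h | h
  · exact key i j hij h
  · rcases key j i (Ne.symm hij) h with h | h
    · exact Or.inl h.symm
    · right; rwa [mul_comm]

end State
end SK


namespace SK
open Module Matrix

variable {n : ℕ} {N : Vx n → Vx n → ℕ} {P Qc B : Mt n}

namespace State
variable (s : State N P Qc B)

def arr (u v : Fin n) : Prop :=
  s.ε u = -1 ∧ s.ε v = -1 ∧ ∃ p q, ¬ ExtZ (s.X (u, p)) (s.X (v, q))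

def Bad (k z : Fin n) : Prop := s.ε z = -1 ∧ ∃ p q, ¬ ExtZ (s.X (z, p)) (s.X (k, q))

def Up (k u : Fin n) : Prop := ∃ z, s.Bad k z ∧ Relation.ReflTransGen s.arr u z

/-- row regularity of `Ext` -/
theorem ext_row {j k : Fin n} (hjk : j ≠ k) (h : ∃ p q, ¬ ExtZ (s.X (j, p)) (s.X (k, q))) (p : ℕ) :
    ∃ q, ¬ ExtZ (s.X (j, p)) (s.X (k, q)) := by
  have hH : ∀ p q, HomZ (s.X (j, p)) (s.X (k, q)) := by
    rcases s.coh j k hjk with h' | h'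
    · exact h'
    · obtain ⟨p, q, h⟩ := h; exact absurd (h' p q) h
  rcases s.block j k hjk with ⟨-, -, h0⟩ | ⟨-, h1, -⟩
  · exfalso
    obtain ⟨p, q, h⟩ := h
    have := h0 p q
    rw [G_apply] at this
    refine h (ext_of_hom (hH p q) ?_)
    rcases s.eps_mul j k with he | he <;> simpa [he] using this
  · obtain ⟨q, hq⟩ := h1 p
    refine ⟨q, fun h' => hq ?_⟩
    rw [G_apply, homext_zero (hH p q) h']; simp

theorem hom_col {j k : Fin n} (hjk : j ≠ k) (h : ∃ p q, ¬ HomZ (s.X (j, p)) (s.X (k, q))) (q : ℕ) :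
    ∃ p, ¬ HomZ (s.X (j, p)) (s.X (k, q)) := by
  have hH : ∀ p q, ExtZ (s.X (j, p)) (s.X (k, q)) := by
    rcases s.coh j k hjk with h' | h'
    · obtain ⟨p, q, h⟩ := h; exact absurd (h' p q) h
    · exact h'
  rcases s.block j k hjk with ⟨-, -, h0⟩ | ⟨-, -, h1⟩
  · exfalso
    obtain ⟨p, q, h⟩ := h
    have := h0 p q
    rw [G_apply] at this
    refine h (hom_of_ext (hH p q) ?_)
    rcases s.eps_mul j k with he | he <;> simpa [he] using this
  · obtain ⟨p, hp⟩ := h1 q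
    refine ⟨p, fun h' => hp ?_⟩
    rw [G_apply, homext_zero h' (hH p q)]; simp

theorem arr_lt {u v : Fin n} (h : s.arr u v) : s.ρ v < s.ρ u := by
  obtain ⟨-, -, p, q, h⟩ := h
  by_contra hc
  exact h (s.ordE _ _ (not_lt.1 hc))

theorem arr_ne {u v : Fin n} (h : s.arr u v) : u ≠ v := by
  intro e; have := s.arr_lt h; rw [e] at this; exact lt_irrefl _ this

theorem chain (k j : Fin n) 
    (hj : ∀ q, ∃ p, ∀ Z, ExtZ Z (s.X (j, p)) → ExtZ Z (s.X (k, q))) (v : Fin n)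
    (hv : Relation.ReflTransGen s.arr j v) :
    ∃ U : ℕ → Rep N, (∀ p p', ExtZ (U p) (U p')) ∧
      (∀ q, ∃ p, ∀ Z, ExtZ Z (U p) → ExtZ Z (s.X (k, q))) ∧
      (∀ w q p, s.ρ w < s.ρ v → ExtZ (s.X (w, q)) (U p)) ∧
      (∃ p q, ∀ Z, ExtZ (U p) Z → ExtZ (s.X (v, q)) Z) := by
  induction hv with
  | refl =>
    exact ⟨fun p => s.X (j, p), fun p p' => s.ordE _ _ le_rfl, hj,
      fun w q p h => s.ordE _ _ h.le, 0, 0, fun Z h => h⟩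
  | @tail v w _ hvw ih =>
    obtain ⟨U, h1, h2, h3, p0, q0, h4⟩ := ih
    have hlt := s.arr_lt hvw
    have hex : ∀ p, ∃ T U' : Rep N, SES T U' (U p) ∧ (∀ q, ExtZ U' (s.X (w, q))) ∧
        AddT (fun q => s.X (w, q)) T ∧
        (∀ q, ¬ ExtZ (U p) (s.X (w, q)) → ∀ W, ExtZ T W → ExtZ (s.X (w, q)) W) := by
      intro p
      obtain ⟨F, hF⟩ := s.fin (U p) w
      obtain ⟨T, U', a, b, c, d, -⟩ := UE (U p) (fun q => s.X (w, q))
        (s.fam w).he F (fun q hq => (hF q hq).2)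
      exact ⟨T, U', a, b, c, d⟩
    choose T U' ha hb hc hd using hex
    refine ⟨U', ?_, ?_, ?_, ?_⟩
    · intro p p'
      refine ((ha p').cov _).surjB ((hc p').2.1 _ (hb p)) ?_
      exact ((ha p).con _).surjB (h1 p p') ((hc p).2.2.2 _ fun q => h3 w q p' hlt)
    · intro q
      obtain ⟨p, hp⟩ := h2 q
      exact ⟨p, fun Z hZ => hp Z (((ha p).cov Z).surjD hZ)⟩
    · intro w' q p hw'
      exact ((ha p).cov _).surjB ((hc p).2.1 _ fun q' => s.ordE _ _ hw'.le)
        (h3 w' q p (hw'.trans hlt))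
    · obtain ⟨q1, hq1⟩ := s.ext_row (s.arr_ne hvw) hvw.2.2 q0
      exact ⟨p0, q1, fun Z hZ => hd p0 q1 (fun h => hq1 (h4 _ h)) Z (((ha p0).con Z).surjD hZ)⟩

theorem notUp (k j : Fin n) (hk : s.ε k = 1)
    (hj : ∀ q, ∃ p, ∀ Z, ExtZ Z (s.X (j, p)) → ExtZ Z (s.X (k, q))) : ¬ s.Up k j := by
  rintro ⟨z, ⟨hz, hz'⟩, hr⟩
  obtain ⟨U, h1, h2, h3, p, q, h4⟩ := s.chain k j hj z hr
  have hzk : z ≠ k := by rintro rfl; rw [hz] at hk; simp at hk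
  obtain ⟨q', hq'⟩ := s.ext_row hzk hz' q
  obtain ⟨p', hp'⟩ := h2 q'
  exact hq' (h4 _ (hp' _ (h1 p p')))

end State
end SK


namespace SK
open Module Matrix

variable {n : ℕ} {N : Vx n → Vx n → ℕ} {P Qc B : Mt n}

noncomputable def dg (c : Fin n → ℤ) (v : Vx n) : Vx n →₀ ℤ := Finsupp.single v (c v.1)

theorem lcb_dg_sum (β : Vx n → Vx n →₀ ℤ) (k : Fin n) (x : Vx n →₀ ℤ) (F : Finset ℕ)
    (hF : ∀ p, p ∉ F → x (k, p) = 0) :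
    lcb β (lcb (dg (fun l => if l = k then 1 else 0)) x) = ∑ p ∈ F, x (k, p) • β (k, p) := by
  classical
  have h1 : lcb β ∘ₗ lcb (dg (fun l => if l = k then 1 else 0)) =
      lcb (fun w : Vx n => if w.1 = k then β w else 0) := by
    ext u : 2
    simp [dg]
  rw [← LinearMap.comp_apply, h1, lcb, Finsupp.linearCombination_apply,
    Finsupp.sum_of_support_subset x
    (Finset.subset_union_left : _ ⊆ x.support ∪ F.image (fun p => (k, p)))
    _ (by simp)]
  symm
  have h2 : ∑ p ∈ F, x (k, p) • β (k, p) = ∑ u ∈ F.image (fun p => ((k, p) : Vx n)),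
      x u • (if u.1 = k then β u else 0) := by
    rw [Finset.sum_image (by intro a _ b _ h; simpa using h)]; simp
  rw [h2]
  apply Finset.sum_subset Finset.subset_union_right
  rintro ⟨a, p⟩ _ hn
  by_cases ha : a = k
  · subst ha
    have : p ∉ F := fun h => hn (by simp [h])
    simp [hF p this]
  · simp [ha]

namespace State
variable (s : State N P Qc B) (k : Fin n)

noncomputable def pk (v : Vx n) : Vx n →₀ ℤ :=
  lcb s.β (lcb (dg (fun l => if l = k then 1 else 0)) (s.G v))

theorem pk_eq (hk : s.ε k = 1) (v : Vx n) (F : Finset ℕ) (hF : ∀ p, p ∉ F → s.G v (k, p) = 0) :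
    s.pk k v = ∑ p ∈ F, s.G v (k, p) • dim (s.X (k, p)) := by
  rw [pk, lcb_dg_sum _ _ _ F hF]
  simp [β, hk]

theorem G_zero {v w : Vx n} (h : HomZ (s.X v) (s.X w)) (h' : ExtZ (s.X v) (s.X w)) :
    s.G v w = 0 := by
  rw [G_apply, homext_zero h h']; simp

def Nn (j : Fin n) : Prop := s.ε j = -1 ∧ ∃ p q, ¬ HomZ (s.X (j, p)) (s.X (k, q))
def isM (j : Fin n) : Prop := s.Nn k j ∧ s.sz j < - s.gr j k * s.sz k

theorem Nn_ne {j : Fin n} (hk : s.ε k = 1) (hj : s.ε j = -1) : j ≠ k := by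
  rintro rfl; rw [hk] at hj; simp at hj

theorem Nn_ext {j : Fin n} (hk : s.ε k = 1) (h : s.Nn k j) (p q) :
    ExtZ (s.X (j, p)) (s.X (k, q)) := by
  rcases s.coh j k (s.Nn_ne k hk h.1) with h' | h'
  · obtain ⟨-, p, q, h⟩ := h; exact absurd (h' p q) h
  · exact h' p q

theorem κy {j : Fin n} (hk : s.ε k = 1) (hj : s.ε j = -1) (p q) :
    HomZ (s.X (k, q)) (s.X (j, p)) ∧ ExtZ (s.X (k, q)) (s.X (j, p)) :=
  ⟨s.ordH _ _ (fun h => s.Nn_ne k hk hj (congrArg Prod.fst h).symm) (s.sgn k j hk hj).le,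
   s.ordE _ _ (s.sgn k j hk hj).le⟩

theorem mkNs {j : Fin n} (hk : s.ε k = 1) (h : s.Nn k j) (p : ℕ) :
    ∃ Z, (s.isM k j ∧ dim Z = - s.pk k (j, p) - dim (s.X (j, p)) ∧
        PropM (fun q => s.X (k, q)) (s.X (j, p)) Z) ∨
      (¬ s.isM k j ∧ dim Z = dim (s.X (j, p)) + s.pk k (j, p) ∧
        PropE (fun q => s.X (k, q)) (s.X (j, p)) Z ∧ (∀ q, ExtZ Z (s.X (k, q))) ∧
         ∀ q, ¬ HomZ (s.X (j, p)) (s.X (k, q)) → ∀ W, ExtZ W (s.X (j, p)) → ExtZ W (s.X (k, q))) := by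
  obtain ⟨F, hF⟩ := s.fin (s.X (j, p)) k
  have hG : ∀ q, s.G (j, p) (k, q) = - (hom (s.X (j, p)) (s.X (k, q)) : ℤ) := fun q => by
    rw [s.G_neg j k _ _ h.1 hk, (extZ_iff _ _).1 (s.Nn_ext k hk h p q)]; simp
  have hF0 : ∀ q, q ∉ F → s.G (j, p) (k, q) = 0 := fun q hq => s.G_zero (hF q hq).1 (hF q hq).2
  obtain ⟨T, Z, hT, hZ⟩ := mkN (s.fam k) (s.X (j, p)) (s.e1 _) (s.ordE _ _ le_rfl)
    (fun q => (s.κy k hk h.1 p q).1) (fun q => (s.κy k hk h.1 p q).2) (s.Nn_ext k hk h p) F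
    (fun q hq => (hF q hq).1)
  have hT1 : dim T = - s.pk k (j, p) := by
    rw [s.pk_eq k hk _ F hF0, hT, ← Finset.sum_neg_distrib]
    exact Finset.sum_congr rfl fun q _ => by rw [hG]; simp
  have hT2 : tot (dim T) = - s.gr j k * s.sz k := by
    rw [hT, map_sum, s.gr_sum j p k F hF0, ← Finset.sum_neg_distrib, Finset.sum_mul]
    exact Finset.sum_congr rfl fun q _ => by rw [hG, map_smul, tot_dim]; simp
  refine ⟨Z, ?_⟩
  rcases hZ with ⟨h0, h1, h2⟩ | ⟨h1, h2⟩
  · left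
    refine ⟨⟨h, ?_⟩, by rw [h1, hT1], h2⟩
    have := tot_pos Z h0
    rw [h1, map_sub, hT2, tot_dim] at this
    linarith
  · right
    refine ⟨?_, by rw [h1, hT1, sub_neg_eq_add], h2⟩
    rintro ⟨-, h3⟩
    have := tot_nonneg Z
    rw [h1, map_sub, hT2, tot_dim] at this
    linarith

theorem E_notUp {j : Fin n} (hk : s.ε k = 1) (h : s.Nn k j) (hM : ¬ s.isM k j) : ¬ s.Up k j := by
  refine s.notUp k j hk fun q => ?_
  obtain ⟨p, hp⟩ := s.hom_col (s.Nn_ne k hk h.1) h.2 q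
  obtain ⟨Z, h1 | h1⟩ := s.mkNs k hk h p
  · exact absurd h1.1 hM
  · exact ⟨p, fun Z hZ => h1.2.2.2.2 q hp Z hZ⟩

theorem M_notUp {j : Fin n} (hk : s.ε k = 1) (hM : s.isM k j) : ¬ s.Up k j := by
  rintro ⟨z, hz, hr⟩
  rcases hr.cases_head with rfl | ⟨w, hw, -⟩
  · obtain ⟨-, p, q, h⟩ := hz
    exact h (s.Nn_ext k hk hM.1 p q)
  · obtain ⟨h1, h2, p, q, h⟩ := hw
    obtain ⟨Z, h3 | h3⟩ := s.mkNs k hk hM.1 p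
    · exact h (h3.2.2.ey _ fun q' => (s.κy k hk h2 q q').2)
    · exact h3.1 hM

open Classical in
noncomputable def ε' (j : Fin n) : ℤ :=
  if j = k then -1 else if s.ε j = 1 then 1 else if s.isM k j then 1 else -1
open Classical in
noncomputable def cc (j : Fin n) : ℤ := if j = k then 0 else if s.ε j = 1 ∨ s.Nn k j then 1 else 0
def σ (j : Fin n) : ℤ := if j = k then -1 else 1

structure New (v : Vx n) (X' : Rep N) : Prop where
  hk : v.1 = k → X' = s.X v
  hP : v.1 ≠ k → s.ε v.1 = 1 → PropP (fun q => s.X (k, q)) (s.X v) X'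
  hP1 : v.1 ≠ k → s.ε v.1 = 1 → s.ρ v.1 ≤ s.ρ k → X' = s.X v
  hM : s.isM k v.1 → PropM (fun q => s.X (k, q)) (s.X v) X'
  hE : s.ε v.1 = -1 → ¬ s.isM k v.1 → PropE (fun q => s.X (k, q)) (s.X v) X'
  hEe : s.ε v.1 = -1 → ¬ s.isM k v.1 → ¬ s.Up k v.1 → ∀ q, ExtZ X' (s.X (k, q))
  hU : s.ε v.1 = -1 → s.Up k v.1 → X' = s.X v
  hd : s.ε' k v.1 • dim X' = σ k v.1 • s.β v - s.cc k v.1 • s.pk k v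

theorem new_ex (hk : s.ε k = 1) (v : Vx n) : ∃ X', s.New k v X' := by
  obtain ⟨j, p⟩ := v
  by_cases hjk : j = k
  · subst hjk
    refine ⟨s.X (j, p), fun _ => rfl, fun h => absurd rfl h, fun h => absurd rfl h, ?_, ?_, ?_, ?_, ?_⟩
    · intro h; have := h.1.1; rw [hk] at this; simp at this
    · intro h; simp only at h; rw [hk] at h; simp at h
    · intro h; simp only at h; rw [hk] at h; simp at h
    · intro h; simp only at h; rw [hk] at h; simp at h
    · simp [ε', σ, cc, β, hk]
  rcases s.hε j with hj | hj
  · have hnM : ¬ s.isM k j := fun h => by have := h.1.1; rw [hj] at this; simp at this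
    have hne : ∀ p q, ((j, p) : Vx n) ≠ (k, q) := fun p q h => hjk (congrArg Prod.fst h)
    have hH : ∀ q, HomZ (s.X (j, p)) (s.X (k, q)) := fun q => s.orth _ _ (hj.trans hk.symm) (hne _ _)
    by_cases hρ : s.ρ j ≤ s.ρ k
    · have hE : ∀ q, ExtZ (s.X (j, p)) (s.X (k, q)) := fun q => s.ordE _ _ hρ
      refine ⟨s.X (j, p), fun h => absurd h hjk, fun _ _ => ?_, fun _ _ _ => rfl, fun h => absurd h hnM,
        ?_, ?_, ?_, ?_⟩
      · exact ⟨fun W h _ => h, fun W h _ => h, fun W h _ => h, fun W h _ => h, hH, hE, s.e1 _⟩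
      · intro h; simp only at h; rw [hj] at h; simp at h
      · intro h; simp only at h; rw [hj] at h; simp at h
      · intro h; simp only at h; rw [hj] at h; simp at h
      · have : s.pk k (j, p) = 0 := by
          rw [s.pk_eq k hk _ ∅ (fun q _ => s.G_zero (hH q) (hE q))]; simp
        rw [this]
        simp [ε', σ, hjk, hj, β]
    · push Not at hρ
      obtain ⟨F, hF⟩ := s.fin (s.X (j, p)) k
      have hF0 : ∀ q, q ∉ F → s.G (j, p) (k, q) = 0 := fun q hq => s.G_zero (hF q hq).1 (hF q hq).2
      obtain ⟨U', h1, h2⟩ := mkP (s.fam k) (s.X (j, p)) (s.e1 _) hH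
        (fun q => s.ordH _ _ (hne _ _).symm hρ.le) (fun q => s.ordE _ _ hρ.le) F
        (fun q hq => (hF q hq).2)
      refine ⟨U', fun h => absurd h hjk, fun _ _ => h1, fun _ _ h => absurd h (not_le.2 hρ),
        fun h => absurd h hnM, ?_, ?_, ?_, ?_⟩
      · intro h; simp only at h; rw [hj] at h; simp at h
      · intro h; simp only at h; rw [hj] at h; simp at h
      · intro h; simp only at h; rw [hj] at h; simp at h
      · have : s.pk k (j, p) = - ∑ q ∈ F, (ext (s.X (j, p)) (s.X (k, q)) : ℤ) • dim (s.X (k, q)) := by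
          rw [s.pk_eq k hk _ F hF0, ← Finset.sum_neg_distrib]
          refine Finset.sum_congr rfl fun q _ => ?_
          rw [G_apply, ← euler, (homZ_iff _ _).1 (hH q)]
          simp [hj, hk]
        rw [this, h2]
        simp [ε', σ, cc, hjk, hj, β]
  · have hj1 : s.ε j ≠ 1 := by rw [hj]; simp
    by_cases hN : s.Nn k j
    · obtain ⟨Z, ⟨h1, h2, h3⟩ | ⟨h1, h2, h3, h4, h5⟩⟩ := s.mkNs k hk hN p
      · refine ⟨Z, fun h => absurd h hjk, fun _ h => absurd h hj1, fun _ h => absurd h hj1, fun _ => h3,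
          fun _ h => absurd h1 h, fun _ h => absurd h1 h, fun _ h => absurd h (s.M_notUp k hk h1), ?_⟩
        simp only [ε', σ, cc, hjk, hj, β, h1, h2, hN, if_false, if_true, or_true]
        simp
        abel
      · refine ⟨Z, fun h => absurd h hjk, fun _ h => absurd h hj1, fun _ h => absurd h hj1,
          fun h => absurd h h1,
          fun _ h => h3, fun _ h _ => h4, fun _ h => absurd h (s.E_notUp k hk hN h1), ?_⟩
        simp only [ε', σ, cc, hjk, hj, β, h1, h2, hN, if_false, if_true, or_true]
        simp
        abel
    · have hnM : ¬ s.isM k j := fun h => hN h.1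
      have hH : ∀ q, HomZ (s.X (j, p)) (s.X (k, q)) := by
        intro q; by_contra hc; exact hN ⟨hj, p, q, hc⟩
      refine ⟨s.X (j, p), fun h => rfl, fun _ h => absurd h hj1, fun _ h => absurd h hj1,
          fun h => absurd h hnM, fun _ h => ?_, fun _ _ h q => ?_, fun _ h => rfl, ?_⟩
      · exact ⟨fun W h _ => h, fun W h => h, fun W h => h, fun W h _ => h, hH, s.e1 _⟩
      · by_contra hc
        exact h ⟨j, ⟨hj, p, q, hc⟩, Relation.ReflTransGen.refl⟩
      · simp [ε', σ, cc, hjk, hj, β, hnM, hN]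

/-! order for the new state -/
open Classical in
noncomputable def cls (j : Fin n) : ℕ :=
  if j = k then 4 else if s.ε j = 1 then 0 else if s.isM k j then 2 else if s.Up k j then 5 else 3

noncomputable def ρ' (j : Fin n) : ℕ := s.cls k j * (∑ i, s.ρ i + 1) + s.ρ j

theorem ρ'_lt {i j} (h : s.cls k i < s.cls k j) : s.ρ' k i < s.ρ' k j := by
  have : s.ρ i ≤ ∑ i, s.ρ i := Finset.single_le_sum (fun _ _ => Nat.zero_le _) (Finset.mem_univ i)
  rw [ρ', ρ']
  nlinarith

theorem ρ'_le {i j} (h : s.ρ' k i ≤ s.ρ' k j) :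
    s.cls k i < s.cls k j ∨ (s.cls k i = s.cls k j ∧ s.ρ i ≤ s.ρ j) := by
  rcases lt_trichotomy (s.cls k i) (s.cls k j) with h1 | h1 | h1
  · exact Or.inl h1
  · right; refine ⟨h1, ?_⟩; rw [ρ', ρ', h1] at h; omega
  · exact absurd (s.ρ'_lt k h1) (not_lt.2 h)

theorem kind (hk : s.ε k = 1) (j : Fin n) :
    (j = k ∧ s.cls k j = 4 ∧ s.ε' k j = -1) ∨
    (j ≠ k ∧ s.ε j = 1 ∧ s.cls k j = 0 ∧ s.ε' k j = 1) ∨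
    (s.ε j = -1 ∧ s.isM k j ∧ s.cls k j = 2 ∧ s.ε' k j = 1) ∨
    (s.ε j = -1 ∧ ¬ s.isM k j ∧ s.Up k j ∧ s.cls k j = 5 ∧ s.ε' k j = -1) ∨
    (s.ε j = -1 ∧ ¬ s.isM k j ∧ ¬ s.Up k j ∧ s.cls k j = 3 ∧ s.ε' k j = -1) := by
  by_cases h : j = k
  · left; simp [h, cls, ε']
  rcases s.hε j with hj | hj
  · right; left; simp [h, hj, cls, ε']
  · by_cases hM : s.isM k j
    · simp [h, hj, hM, cls, ε']
    · by_cases hU : s.Up k j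
      · simp [h, hj, hM, hU, cls, ε']
      · simp [h, hj, hM, hU, cls, ε']

variable {s k} in
theorem new_pairs (hk : s.ε k = 1) {v w : Vx n} {Xv Xw : Rep N} (hv : s.New k v Xv)
    (hw : s.New k w Xw) (hvw : v = w → Xv = Xw) :
    (v ≠ w → s.ρ' k v.1 ≤ s.ρ' k w.1 ∨ s.ε' k v.1 = s.ε' k w.1 → HomZ Xv Xw) ∧
    (s.ρ' k v.1 ≤ s.ρ' k w.1 → ExtZ Xv Xw) := by
  have hyy : ∀ {v w : Vx n}, s.ε v.1 = -1 → s.ε w.1 = -1 → v ≠ w → HomZ (s.X v) (s.X w) :=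
    fun h1 h2 h => s.orth _ _ (h1.trans h2.symm) h
  have hκw : s.ε w.1 = -1 → (∀ q, HomZ (s.X (k, q)) (s.X w)) ∧ (∀ q, ExtZ (s.X (k, q)) (s.X w)) :=
    fun h => ⟨fun q => (s.κy k hk h w.2 q).1, fun q => (s.κy k hk h w.2 q).2⟩
  have hκP : w.1 ≠ k → s.ε w.1 = 1 → ∀ q, HomZ (s.X (k, q)) (s.X w) := fun h1 h2 q =>
    s.orth _ _ (hk.trans h2.symm) (fun h => h1 (congrArg Prod.fst h).symm)
  have hwk : w.1 = k → Xw = s.X (k, w.2) := by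
    intro h; rw [hw.hk h]; congr 1; exact Prod.ext h rfl
  have hvk : v.1 = k → Xv = s.X (k, v.2) := by
    intro h; rw [hv.hk h]; congr 1; exact Prod.ext h rfl
  have hne : v.1 ≠ w.1 → v ≠ w := fun h h' => h (congrArg Prod.fst h')
  have hle : ∀ {a b : ℕ}, s.cls k v.1 = a → s.cls k w.1 = b → s.ρ' k v.1 ≤ s.ρ' k w.1 →
      a < b ∨ (a = b ∧ s.ρ v.1 ≤ s.ρ w.1) := by
    intro a b ha hb h; rw [← ha, ← hb]; exact s.ρ'_le k h
  rcases s.kind k hk v.1 with ⟨v1, v2, v3⟩ | ⟨v0, v1, v2, v3⟩ | ⟨v0, v1, v2, v3⟩ | v1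
  · -- v = k
    rcases s.kind k hk w.1 with ⟨w1, w2, w3⟩ | ⟨w0, w1, w2, w3⟩ | ⟨w0, w1, w2, w3⟩ | ⟨w0, w1, w4, w2, w3⟩ | ⟨w0, w1, w4, w2, w3⟩
    · rw [hvk v1, hwk w1]
      refine ⟨fun h _ => s.ordH _ _ ?_ le_rfl, fun _ => s.ordE _ _ le_rfl⟩
      intro h'
      exact h (Prod.ext (v1.trans w1.symm) (Prod.mk.inj h').2)
    · refine ⟨fun h h' => ?_, fun h => ?_⟩
      · rcases h' with h' | h'
        · have := hle v2 w2 h'; omega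
        · rw [v3, w3] at h'; simp at h'
      · have := hle v2 w2 h; omega
    · refine ⟨fun h h' => ?_, fun h => ?_⟩
      · rcases h' with h' | h'
        · have := hle v2 w2 h'; omega
        · rw [v3, w3] at h'; simp at h'
      · have := hle v2 w2 h; omega
    · rw [hvk v1]
      refine ⟨fun _ _ => (hw.hE w0 w1).hr _ ((hκw w0).1 _), fun _ => ?_⟩
      rw [hw.hU w0 w4]; exact (hκw w0).2 _
    · rw [hvk v1]
      refine ⟨fun _ _ => (hw.hE w0 w1).hr _ ((hκw w0).1 _), fun h => ?_⟩
      have := hle v2 w2 h; omega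
  · -- v of type P
    have pv := hv.hP v0 v1
    have hy : s.ε w.1 = -1 → HomZ Xv (s.X w) ∧ ExtZ Xv (s.X w) := by
      intro h
      have hlt := s.sgn _ _ v1 h
      refine ⟨pv.hl _ (s.ordH _ _ (fun h => ?_) hlt.le) (hκw h).1,
        pv.el _ (s.ordE _ _ hlt.le) (hκw h).2⟩
      rw [h] at hlt; exact lt_irrefl _ hlt
    rcases s.kind k hk w.1 with ⟨w1, w2, w3⟩ | ⟨w0, w1, w2, w3⟩ | ⟨w0, w1, w2, w3⟩ | w1
    · rw [hwk w1]; exact ⟨fun _ _ => pv.hκ _, fun _ => pv.eκ _⟩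
    · have pw := hw.hP w0 w1
      refine ⟨fun h _ => ?_, fun h => ?_⟩
      · exact pw.hr _ (pv.hl _ (s.orth _ _ (v1.trans w1.symm) h) (hκP w0 w1)) pv.hκ
      · have hρ : s.ρ v.1 ≤ s.ρ w.1 := by have := hle v2 w2 h; omega
        refine pw.er _ ?_ pv.eκ
        by_cases hc : s.ρ v.1 ≤ s.ρ k
        · rw [hv.hP1 v0 v1 hc]; exact s.ordE _ _ hρ
        · exact pv.el _ (s.ordE _ _ hρ) fun q => s.ordE _ _ ((not_le.1 hc).le.trans hρ)
    · have pw := hw.hM w1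
      exact ⟨fun _ _ => pw.hr _ pv.hκ (hy w0).2, fun _ => pw.er _ pv.eκ⟩
    · have w0 : s.ε w.1 = -1 := by rcases w1 with w | w <;> exact w.1
      have w2 : ¬ s.isM k w.1 := by rcases w1 with w | w <;> exact w.2.1
      have pw := hw.hE w0 w2
      exact ⟨fun _ _ => pw.hr _ (hy w0).1, fun _ => pw.er _ (hy w0).2 pv.hκ⟩
  · -- v of type M
    have pv := hv.hM v1
    rcases s.kind k hk w.1 with ⟨w1, w2, w3⟩ | ⟨w0, w1, w2, w3⟩ | ⟨w0, w1, w2, w3⟩ | w1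
    · rw [hwk w1]; exact ⟨fun _ _ => pv.hκ _, fun _ => pv.eκ _⟩
    · have pw := hw.hP w0 w1
      refine ⟨fun h _ => pw.hr _ (pv.hl _ (hκP w0 w1)) pv.hκ, fun h => ?_⟩
      have := hle v2 w2 h; omega
    · have pw := hw.hM w1
      exact ⟨fun h _ => pw.hr _ pv.hκ (pv.el _ (hyy v0 w0 h) (hκw w0).2), fun _ => pw.er _ pv.eκ⟩
    · have w0 : s.ε w.1 = -1 := by rcases w1 with w | w <;> exact w.1
      have w2 : ¬ s.isM k w.1 := by rcases w1 with w | w <;> exact w.2.1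
      have pw := hw.hE w0 w2
      have hne' : v ≠ w := hne fun h => w2 (h ▸ v1)
      exact ⟨fun _ _ => pw.hr _ (pv.hl _ (hκw w0).1),
        fun _ => pw.er _ (pv.el _ (hyy v0 w0 hne') (hκw w0).2) pv.hκ⟩
  · -- v of type N
    have v0 : s.ε v.1 = -1 := by rcases v1 with w | w <;> exact w.1
    have v2 : ¬ s.isM k v.1 := by rcases v1 with w | w <;> exact w.2.1
    have v3 : s.ε' k v.1 = -1 := by rcases v1 with w | w <;> exact w.2.2.2.2
    have v4 : 3 ≤ s.cls k v.1 := by rcases v1 with w | w <;> rw [w.2.2.2.1] <;> norm_num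
    have pv := hv.hE v0 v2
    rcases s.kind k hk w.1 with ⟨w1, w2, w3⟩ | ⟨w0, w1, w2, w3⟩ | ⟨w0, w1, w2, w3⟩ | w1
    · rw [hwk w1]
      refine ⟨fun _ _ => pv.hκ _, fun h => ?_⟩
      rcases v1 with v1 | v1
      · have := hle v1.2.2.2.1 w2 h; omega
      · exact hv.hEe v0 v2 v1.2.2.1 _
    · refine ⟨fun h h' => ?_, fun h => ?_⟩
      · rcases h' with h' | h'
        · have := hle rfl w2 h'; omega
        · rw [v3, w3] at h'; simp at h'
      · have := hle rfl w2 h; omega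
    · refine ⟨fun h h' => ?_, fun h => ?_⟩
      · rcases h' with h' | h'
        · have := hle rfl w2 h'; omega
        · rw [v3, w3] at h'; simp at h'
      · have := hle rfl w2 h; omega
    · have w0 : s.ε w.1 = -1 := by rcases w1 with w | w <;> exact w.1
      have w2 : ¬ s.isM k w.1 := by rcases w1 with w | w <;> exact w.2.1
      have pw := hw.hE w0 w2
      refine ⟨fun h _ => pw.hr _ (pv.hl _ (hyy v0 w0 h) (hκw w0).2), fun h => ?_⟩
      refine pw.er _ (pv.el _ ?_) pv.hκ
      by_contra hc
      have harr : s.arr v.1 w.1 := ⟨v0, w0, v.2, w.2, hc⟩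
      have hlt := s.arr_lt harr
      rcases v1 with v1 | v1 <;> rcases w1 with w1 | w1
      · have := hle v1.2.2.2.1 w1.2.2.2.1 h; omega
      · have := hle v1.2.2.2.1 w1.2.2.2.1 h; omega
      · obtain ⟨z, hz, hr⟩ := w1.2.2.1
        exact v1.2.2.1 ⟨z, hz, Relation.ReflTransGen.head harr hr⟩
      · have := hle v1.2.2.2.1 w1.2.2.2.1 h; omega

theorem new_e1 (hk : s.ε k = 1) {v : Vx n} {Xv : Rep N} (hv : s.New k v Xv) :
    E N (dim Xv) (dim Xv) = 1 := by
  rcases s.kind k hk v.1 with ⟨v1, v2, v3⟩ | ⟨v0, v1, v2, v3⟩ | ⟨v0, v1, v2, v3⟩ | v1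
  · rw [hv.hk v1]; exact s.e1 _
  · exact (hv.hP v0 v1).e1
  · exact (hv.hM v1).e1
  · have v0 : s.ε v.1 = -1 := by rcases v1 with w | w <;> exact w.1
    have v2 : ¬ s.isM k v.1 := by rcases v1 with w | w <;> exact w.2.1
    exact (hv.hE v0 v2).e1

end State
end SK


namespace SK
open Module Matrix

variable {n : ℕ} {N : Vx n → Vx n → ℕ} {P Qc B : Mt n}

namespace State

section
variable (s : State N P Qc B) (k : Fin n)

theorem sign_nonneg (i : Fin n) (h : ∀ p q, 0 ≤ s.G (i, p) (k, q)) :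
    0 ≤ s.gr i k ∧ 0 ≤ s.gc i k := by
  constructor
  · rw [← s.regG.row (i, 0) k]; exact lam_nonneg _ _ (h 0)
  · rw [← s.regG.col (k, 0) i]; exact lam_nonneg _ _ (fun p => by rw [← s.regG.tr]; exact h p 0)

theorem sign_nonpos (i : Fin n) (h : ∀ p q, s.G (i, p) (k, q) ≤ 0) :
    s.gr i k ≤ 0 ∧ s.gc i k ≤ 0 := by
  have h1 : 0 ≤ lam k (- s.G (i, 0)) := lam_nonneg _ _ (fun p => by simpa using h 0 p)
  have h2 : 0 ≤ lam i (- s.G' (k, 0)) := lam_nonneg _ _ (fun p => by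
    rw [Finsupp.neg_apply, ← s.regG.tr]; simpa using h p 0)
  rw [map_neg, s.regG.row] at h1
  rw [map_neg, s.regG.col] at h2
  simp only at h1 h2
  constructor <;> linarith

theorem cc_eq (hk : s.ε k = 1) (i : Fin n) (hik : i ≠ k) :
    - (s.cc k i * s.gr i k) = max (B i k) 0 ∧ - (s.cc k i * s.gc i k) = max (- B k i) 0 := by
  have b1 := s.B_eq i k
  have b2 := s.B_eq k i
  have hne : ∀ p q, ((i, p) : Vx n) ≠ (k, q) := fun p q h => hik (congrArg Prod.fst h)
  rcases s.hε i with hi | hi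
  · have hc : s.cc k i = 1 := by simp [cc, hik, hi]
    have hH : ∀ p q, s.G (i, p) (k, q) ≤ 0 := fun p q => by
      rw [G_apply, ← euler, (homZ_iff _ _).1 (s.orth _ _ (hi.trans hk.symm) (hne p q))]
      simp [hi, hk]
    have hH' : ∀ p q, s.G (k, p) (i, q) ≤ 0 := fun p q => by
      rw [G_apply, ← euler, (homZ_iff _ _).1 (s.orth _ _ (hk.trans hi.symm) (hne q p).symm)]
      simp [hi, hk]
    obtain ⟨h1, h2⟩ := s.sign_nonpos k i hH
    obtain ⟨h3, h4⟩ := s.sign_nonpos i k hH'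
    rw [hc, b1, b2]
    rcases le_total (s.ρ i) (s.ρ k) with h | h
    · obtain ⟨h5, h6⟩ := s.g_ord i k hik h
      rw [h5, h6]
      constructor
      · rw [max_eq_right] <;> linarith
      · rw [max_eq_right] <;> linarith
    · obtain ⟨h5, h6⟩ := s.g_ord k i hik.symm h
      rw [h5, h6]
      constructor
      · rw [max_eq_left] <;> linarith
      · rw [max_eq_left] <;> linarith
  · obtain ⟨h5, h6⟩ := s.g_ord k i hik.symm (s.sgn k i hk hi).le
    rw [b1, b2, h5, h6]
    by_cases hN : s.Nn k i
    · have hc : s.cc k i = 1 := by simp [cc, hik, hN]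
      obtain ⟨h1, h2⟩ := s.sign_nonpos k i (fun p q => by
        rw [s.G_neg i k _ _ hi hk, (extZ_iff _ _).1 (s.Nn_ext k hk hN p q)]; simp)
      rw [hc]
      constructor
      · rw [max_eq_left] <;> linarith
      · rw [max_eq_left] <;> linarith
    · have hc : s.cc k i = 0 := by simp [cc, hik, hN, hi]
      obtain ⟨h1, h2⟩ := s.sign_nonneg k i (fun p q => by
        have : HomZ (s.X (i, p)) (s.X (k, q)) := by
          by_contra hcon; exact hN ⟨hi, p, q, hcon⟩
        rw [s.G_neg i k _ _ hi hk, (homZ_iff _ _).1 this]; simp)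
      rw [hc]
      constructor
      · rw [max_eq_right] <;> linarith
      · rw [max_eq_right] <;> linarith

noncomputable def ar : Mt n :=
  diagonal (σ k) - diagonal (s.cc k) * (s.gr * diagonal (fun l => if l = k then 1 else 0))
noncomputable def as : Mt n :=
  diagonal (σ k) - diagonal (s.cc k) * (s.gc * diagonal (fun l => if l = k then 1 else 0))

theorem reg_new : ∃ β'', Reg (fun v => σ k v.1 • s.β v - s.cc k v.1 • s.pk k v) β''
    (s.ar k * s.R) (s.as k * s.S) := by
  have h := (((reg_diag (n := n) (σ k)).sub ((reg_diag (s.cc k)).mul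
    (s.regG.mul (reg_diag (fun l => if l = k then 1 else 0)))))).mul s.reg
  have gen : ∀ {M1 M M' : Vx n → Vx n →₀ ℤ} {r t : Mt n}, Reg M M' r t → M1 = M →
      ∃ b, Reg M1 b r t := by
    intro M1 M M' r t h e
    subst e; exact ⟨_, h⟩
  refine gen h ?_
  funext v
  simp only [Pi.sub_apply, map_sub, Finsupp.linearCombination_single, map_smul]
  rfl

theorem mul_entry (k : Fin n) (B : Mt n) (hB : B k k = 0) (c σ : Fin n → ℤ) (g h : Mt n) (i j : Fin n) :
   (((diagonal σ - diagonal c * (g * diagonal (fun l => if l = k then 1 else 0))) * B *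
    (diagonal σ - diagonal c * (h * diagonal (fun l => if l = k then 1 else 0)))ᵀ : Mt n)) i j =
    σ i * σ j * B i j - σ j * (c i * g i k * B k j) - σ i * (c j * h j k * B i k) := by
  have h1 : ∀ (c : Fin n → ℤ) (g : Mt n) (i l : Fin n),
    (diagonal σ - diagonal c * (g * diagonal (fun l => if l = k then 1 else 0)) : Mt n) i l =
     (if i = l then σ i else 0) - (if l = k then c i * g i k else 0) := by
    intro c g i l
    rw [Matrix.sub_apply, diagonal_mul, mul_diagonal, diagonal_apply]
    congr 1
    split_ifs with h
    · rw [h]; simp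
    · simp
  rw [mul_apply]
  simp only [transpose_apply, mul_apply, h1]
  simp [sub_mul, mul_sub, Finset.sum_sub_distrib, ite_mul, mul_ite, hB]
  ring

theorem green (hk : s.ε k = 1) : Nonempty (State N P Qc (matMut k B)) := by
  choose X' hX using s.new_ex k hk
  obtain ⟨β'', hβ⟩ := s.reg_new k
  have hmut : matMut k B = s.ar k * s.R * (P - Qcᵀ) * (s.as k * s.S)ᵀ := by
    have e : s.ar k * s.R * (P - Qcᵀ) * (s.as k * s.S)ᵀ = s.ar k * B * (s.as k)ᵀ := by
      have := s.mat
      have e2 : s.ar k * B * (s.as k)ᵀ = s.ar k * (s.R * (P - Qcᵀ) * s.Sᵀ) * (s.as k)ᵀ :=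
        congrArg (fun M => s.ar k * M * (s.as k)ᵀ) this
      rw [e2, transpose_mul]
      simp only [Matrix.mul_assoc]
    have hkk : B k k = 0 := by
      have := s.B_eq k k
      rw [this, (s.g_diag k).1, (s.g_diag k).2]; simp
    rw [e]
    ext i j
    rw [ar, as, mul_entry k B hkk]
    by_cases hi : i = k
    · subst hi
      have : s.cc i i = 0 := by simp [cc]
      rw [this, matMut, hkk]
      by_cases hj : j = i
      · subst hj; simp [hkk]
      · simp [σ, hj]
    by_cases hj : j = k
    · subst hj
      have : s.cc j j = 0 := by simp [cc]
      rw [this, matMut, hkk]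
      simp [σ, hi]
    obtain ⟨h1, -⟩ := s.cc_eq k hk i hi
    obtain ⟨-, h2⟩ := s.cc_eq k hk j hj
    have e1 : s.cc k i * s.gr i k = - max (B i k) 0 := by linarith
    have e2 : s.cc k j * s.gc j k = - max (- B k j) 0 := by linarith
    rw [e1, e2]
    simp only [matMut, σ, hi, hj, or_self, if_false]
    have key : |B i k| * B k j + B i k * |B k j| =
        2 * (max (B i k) 0 * B k j + max (- B k j) 0 * B i k) := by
      rcases le_total 0 (B i k) with a | a <;> rcases le_total 0 (B k j) with b | b
      · rw [abs_of_nonneg a, abs_of_nonneg b, max_eq_left a, max_eq_right (by linarith)]; ring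
      · rw [abs_of_nonneg a, abs_of_nonpos b, max_eq_left a, max_eq_left (by linarith)]; ring
      · rw [abs_of_nonpos a, abs_of_nonneg b, max_eq_right a, max_eq_right (by linarith)]; ring
      · rw [abs_of_nonpos a, abs_of_nonpos b, max_eq_right a, max_eq_left (by linarith)]; ring
    rw [key, Int.mul_ediv_cancel_left _ (by norm_num)]
    ring
  exact ⟨{
    X := X'
    ε := s.ε' k
    hε := fun i => by
      rcases s.kind k hk i with h | h | h | h | h
      · exact Or.inr h.2.2
      · exact Or.inl h.2.2.2
      · exact Or.inl h.2.2.2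
      · exact Or.inr h.2.2.2.2
      · exact Or.inr h.2.2.2.2
    ρ := s.ρ' k
    ordH := fun v w h h' => (new_pairs hk (hX v) (hX w) (fun h => h ▸ rfl)).1 h (Or.inl h')
    ordE := fun v w h => (new_pairs hk (hX v) (hX w) (fun h => h ▸ rfl)).2 h
    e1 := fun v => s.new_e1 k hk (hX v)
    orth := fun v w h h' => (new_pairs hk (hX v) (hX w) (fun h => h ▸ rfl)).1 h' (Or.inr h)
    sgn := fun i j hi hj => by
      apply s.ρ'_lt
      rcases s.kind k hk i with h | h | h | h | h <;> rcases s.kind k hk j with h' | h' | h' | h' | h' <;>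
      omega
    rq := s.rq
    β' := β''
    R := s.ar k * s.R
    S := s.as k * s.S
    reg := by
      have e : (fun v : Vx n => s.ε' k v.1 • dim (X' v)) =
        (fun v => σ k v.1 • s.β v - s.cc k v.1 • s.pk k v) := funext fun v => (hX v).hd
      rw [e]; exact hβ
    mat := hmut }⟩

/-- dual state -/
noncomputable def dual : State (opN N) Qcᵀ Pᵀ (-B) where
  X v := D (s.X v)
  ε i := - s.ε i
  hε i := by rcases s.hε i with h | h <;> simp [h]
  ρ i := (∑ i, s.ρ i) - s.ρ i
  ordH v w h h' := by
    have h1 : ∀ i, s.ρ i ≤ ∑ i, s.ρ i := fun i =>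
      Finset.single_le_sum (fun _ _ => Nat.zero_le _) (Finset.mem_univ i)
    have := h1 v.1; have := h1 w.1
    exact D_HomZ (s.ordH w v h.symm (by omega))
  ordE v w h' := by
    have h1 : ∀ i, s.ρ i ≤ ∑ i, s.ρ i := fun i =>
      Finset.single_le_sum (fun _ _ => Nat.zero_le _) (Finset.mem_univ i)
    have := h1 v.1; have := h1 w.1
    exact D_ExtZ (s.ordE w v (by omega))
  e1 v := by rw [E_op, D_dim, s.e1]
  orth v w h h' := D_HomZ (s.orth w v (by linarith) h'.symm)
  sgn i j hi hj := by
    have h1 : ∀ i, s.ρ i ≤ ∑ i, s.ρ i := fun i =>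
      Finset.single_le_sum (fun _ _ => Nat.zero_le _) (Finset.mem_univ i)
    have := h1 i; have := h1 j
    have := s.sgn j i (by linarith) (by linarith)
    omega
  rq := s.rq.op
  β' := - s.β'
  R := - s.R
  S := - s.S
  reg := by
    have e : (fun v : Vx n => (- s.ε v.1) • dim (D (s.X v))) = - (fun v => s.ε v.1 • dim (s.X v)) := by
      funext v; rw [D_dim]; simp
    rw [e]; exact s.reg.neg
  mat := by
    have e : (-s.R) * (Qcᵀ - Pᵀᵀ) * (-s.S)ᵀ = - (s.R * (P - Qcᵀ) * s.Sᵀ) := by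
      rw [transpose_transpose, transpose_neg, ← neg_sub P, Matrix.mul_neg, Matrix.mul_neg,
        Matrix.neg_mul, Matrix.neg_mul, neg_neg, Matrix.neg_mul]
    rw [e]; exact congrArg Neg.neg s.mat

theorem matMut_neg (k : Fin n) (B : Mt n) : matMut k (-B) = - matMut k B := by
  ext i j
  simp only [matMut, neg_apply, abs_neg]
  split_ifs
  · rfl
  · have : |B i k| * -B k j + -B i k * |B k j| = - (|B i k| * B k j + B i k * |B k j|) := by ring
    have h2 : (2 : ℤ) ∣ |B i k| * B k j + B i k * |B k j| := by
      rcases abs_choice (B i k) with h | h <;> rcases abs_choice (B k j) with h' | h' <;>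
        rw [h, h'] <;> ring_nf <;> simp
    rw [this, Int.neg_ediv_of_dvd h2]; ring

end

theorem step (s : State N P Qc B) (k : Fin n) : Nonempty (State N P Qc (matMut k B)) := by
  rcases s.hε k with hk | hk
  · exact s.green k hk
  · obtain ⟨t⟩ := s.dual.green k (by change - s.ε k = 1; rw [hk]; simp)
    have := t.dual
    rw [matMut_neg, neg_neg, transpose_transpose, transpose_transpose] at this
    exact ⟨this⟩

end State
end SK


namespace SK
open Module

/-! ### the initial state -/

def ov (a b p q : ℕ) : ℕ := (Finset.Ico (p * a) ((p + 1) * a) ∩ Finset.Ico (q * b) ((q + 1) * b)).card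

theorem ov_comm (a b p q : ℕ) : ov a b p q = ov b a q p := by
  unfold ov; rw [Finset.inter_comm]

theorem ov_bound {a b p q : ℕ} (hb : 0 < b) (h : ov a b p q ≠ 0) : q < (p + 1) * a := by
  unfold ov at h
  rw [Finset.card_ne_zero] at h
  obtain ⟨x, hx⟩ := h
  simp only [Finset.mem_inter, Finset.mem_Ico] at hx
  have : q ≤ q * b := Nat.le_mul_of_pos_right _ hb
  omega

theorem ov_sum {a b p : ℕ} (hb : 0 < b) (F : Finset ℕ) (hF : ∀ q, q ∉ F → ov a b p q = 0) :
    ∑ q ∈ F, ov a b p q = a := by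
  have hdiv : ∀ x q : ℕ, x / b = q ↔ x ∈ Finset.Ico (q * b) ((q + 1) * b) := by
    intro x q
    rw [Nat.div_eq_iff hb, Finset.mem_Ico, Nat.succ_mul]
    omega
  have h1 : (Finset.Ico (p * a) ((p + 1) * a)).card = a := by
    rw [Nat.card_Ico, Nat.succ_mul]; omega
  have h2 := Finset.card_eq_sum_card_fiberwise (s := Finset.Ico (p * a) ((p + 1) * a))
    (f := fun x => x / b) (t := F) (by
      intro x hx
      by_contra hn
      have h0 := hF _ hn
      unfold ov at h0
      rw [Finset.card_eq_zero] at h0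
      have : x ∈ (∅ : Finset ℕ) := by
        rw [← h0]
        exact Finset.mem_inter.2 ⟨hx, (hdiv _ _).1 rfl⟩
      simp at this)
  rw [h1] at h2
  refine Eq.trans ?_ h2.symm
  refine Finset.sum_congr rfl fun q _ => ?_
  unfold ov
  congr 1
  ext x
  simp only [Finset.mem_inter, Finset.mem_filter, hdiv]

variable {n : ℕ}

def N0 (B : Mt n) (v w : Vx n) : ℕ :=
  if 0 < B v.1 w.1 then ov (B v.1 w.1).natAbs (B w.1 v.1).natAbs v.2 w.2 else 0

def P0 (B : Mt n) : Mt n := fun l m => if 0 < B l m then ((B l m).natAbs : ℤ) else 0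
def Q0 (B : Mt n) : Mt n := fun l m => if 0 < B l m then ((B m l).natAbs : ℤ) else 0

theorem P0_sub (B : Mt n) (h : ∀ i j, (B i j = 0 ∧ B j i = 0) ∨ B i j * B j i < 0) :
    P0 B - (Q0 B).transpose = B := by
  ext l m
  simp only [Matrix.sub_apply, Matrix.transpose_apply, P0, Q0]
  rcases h l m with ⟨h1, h2⟩ | h1
  · simp [h1, h2]
  · rcases mul_neg_iff.1 h1 with ⟨h2, h3⟩ | ⟨h2, h3⟩
    · rw [if_pos h2, if_neg (by omega)]; omega
    · rw [if_pos h3, if_neg (by omega)]; omega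

noncomputable def bx (f : Fin n → ℕ) : Finset (Vx n) :=
  Finset.univ.biUnion fun m => {m} ×ˢ Finset.range (f m)

theorem mem_bx (f : Fin n → ℕ) (v : Vx n) : v ∈ bx f ↔ v.2 < f v.1 := by
  simp only [bx, Finset.mem_biUnion, Finset.mem_univ, true_and, Finset.mem_product,
    Finset.mem_singleton, Finset.mem_range]
  constructor
  · rintro ⟨m, h, h'⟩; rwa [h]
  · intro h; exact ⟨_, rfl, h⟩

theorem regQ0 (B : Mt n) (h : ∀ i j, (B i j = 0 ∧ B j i = 0) ∨ B i j * B j i < 0) :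
    RegQ (N0 B) (P0 B) (Q0 B) := by
  have hpos : ∀ i j, 0 < B i j → 0 < (B j i).natAbs := by
    intro i j hij
    rcases h i j with ⟨h1, h2⟩ | h1
    · omega
    · rw [Int.natAbs_pos]; rintro h0; simp [h0] at h1
  have b1 : ∀ v w, N0 B v w ≠ 0 → w.2 < (v.2 + 1) * (B v.1 w.1).natAbs := by
    intro v w hv
    unfold N0 at hv
    split_ifs at hv with h0
    · exact ov_bound (hpos _ _ h0) hv
    · exact absurd rfl hv
  have b2 : ∀ v w, N0 B v w ≠ 0 → v.2 < (w.2 + 1) * (B w.1 v.1).natAbs := by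
    intro v w hv
    unfold N0 at hv
    split_ifs at hv with h0
    · rw [ov_comm] at hv
      exact ov_bound (by omega) hv
    · exact absurd rfl hv
  refine ⟨fun v => Finsupp.onFinset (bx fun m => (v.2 + 1) * (B v.1 m).natAbs)
      (fun w => (N0 B v w : ℤ)) (fun w hw => (mem_bx _ _).2 (b1 v w (by exact_mod_cast hw))),
    fun w => Finsupp.onFinset (bx fun m => (w.2 + 1) * (B w.1 m).natAbs)
      (fun v => (N0 B v w : ℤ)) (fun v hv => (mem_bx _ _).2 (b2 v w (by exact_mod_cast hv))),
    fun v w => rfl, fun v w => rfl, ?_, ?_⟩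
  · intro v m
    have hF : ∀ q, q ∉ Finset.range ((v.2 + 1) * (B v.1 m).natAbs) → N0 B v (m, q) = 0 := by
      intro q hq
      by_contra hn
      exact hq (Finset.mem_range.2 (b1 v (m, q) hn))
    rw [lam_sum m _ (Finset.range ((v.2 + 1) * (B v.1 m).natAbs))
      (fun q hq => by simp only [Finsupp.onFinset_apply]; exact_mod_cast hF q hq)]
    simp only [Finsupp.onFinset_apply, P0]
    split_ifs with h0
    · rw [← Nat.cast_sum]
      congr 1
      simp only [N0, if_pos h0] at hF ⊢
      exact ov_sum (hpos _ _ h0) _ hF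
    · simp [N0, h0]
  · intro w l
    have hF : ∀ q, q ∉ Finset.range ((w.2 + 1) * (B w.1 l).natAbs) → N0 B (l, q) w = 0 := by
      intro q hq
      by_contra hn
      exact hq (Finset.mem_range.2 (b2 (l, q) w hn))
    rw [lam_sum l _ (Finset.range ((w.2 + 1) * (B w.1 l).natAbs))
      (fun q hq => by simp only [Finsupp.onFinset_apply]; exact_mod_cast hF q hq)]
    simp only [Finsupp.onFinset_apply, Q0]
    split_ifs with h0
    · rw [← Nat.cast_sum]
      congr 1
      simp only [N0, if_pos h0] at hF ⊢
      simp only [ov_comm (B l w.1).natAbs] at hF ⊢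
      exact ov_sum (by omega) _ hF
    · simp [N0, h0]

noncomputable def simp0 (N : Vx n → Vx n → ℕ) (v : Vx n) : Rep N where
  X w := Fin (if w = v then 1 else 0) → ℚ
  f _ _ _ := 0
  S := {v}
  hS w hw := by
    rw [Finset.mem_singleton] at hw
    rw [if_neg hw]; infer_instance

theorem simp0_dim (N : Vx n → Vx n → ℕ) (v : Vx n) : dim (simp0 N v) = Finsupp.single v 1 := by
  ext w
  rw [dim_apply]
  have h0 : finrank ℚ ((simp0 N v).X w) = if w = v then 1 else 0 :=
    finrank_fin_fun (R := ℚ) (n := if w = v then 1 else 0)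
  rw [h0, Finsupp.single_apply]
  by_cases h : w = v
  · simp [h]
  · rw [if_neg h, if_neg (Ne.symm h)]; rfl

theorem simp0_hom (N : Vx n → Vx n → ℕ) {v w : Vx n} (h : v ≠ w) :
    HomZ (simp0 N v) (simp0 N w) := by
  refine homZ_of_disj fun u => ?_
  rw [simp0_dim, simp0_dim, Finsupp.single_apply, Finsupp.single_apply]
  by_cases h1 : v = u
  · right; rw [if_neg]; rintro rfl; exact h h1
  · left; rw [if_neg h1]

theorem simp0_E (N : Vx n → Vx n → ℕ) (v w : Vx n) :
    E N (dim (simp0 N v)) (dim (simp0 N w)) = (if v = w then 1 else 0) - N v w := by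
  rw [simp0_dim, simp0_dim]; simp [E]

theorem simp0_ext (N : Vx n → Vx n → ℕ) {v w : Vx n} (h : N v w = 0) :
    ExtZ (simp0 N v) (simp0 N w) := by
  intro c
  refine ⟨0, ?_⟩
  funext a b i
  by_cases ha : a = v
  · by_cases hb : b = w
    · subst ha hb; rw [h] at i; exact i.elim0
    · have : Subsingleton ((simp0 N w).X b) := (simp0 N w).hS b (by simpa [simp0] using hb)
      ext x; exact Subsingleton.elim _ _
  · have : Subsingleton ((simp0 N v).X a) := (simp0 N v).hS a (by simpa [simp0] using ha)
    ext x; rw [Subsingleton.elim x 0, map_zero, map_zero]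

open Classical in
theorem state0 (B : Mt n) (h : ∀ i j, (B i j = 0 ∧ B j i = 0) ∨ B i j * B j i < 0)
    (hac : ∀ i, ¬ Relation.TransGen (fun i j => 0 < B i j) i i) :
    Nonempty (State (N0 B) (P0 B) (Q0 B) B) := by
  let ρ : Fin n → ℕ := fun i =>
    (Finset.univ.filter fun j => Relation.TransGen (fun i j => 0 < B i j) i j).card
  have hρ : ∀ i j, 0 < B i j → ρ j < ρ i := by
    intro i j hij
    refine Finset.card_lt_card (Finset.ssubset_iff_of_subset ?_ |>.2 ⟨j, ?_, ?_⟩)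
    · intro x hx
      simp only [Finset.mem_filter, Finset.mem_univ, true_and] at hx ⊢
      exact Relation.TransGen.head hij hx
    · simp only [Finset.mem_filter, Finset.mem_univ, true_and]
      exact Relation.TransGen.single hij
    · simp only [Finset.mem_filter, Finset.mem_univ, true_and]
      exact hac j
  have hN : ∀ v w : Vx n, ρ v.1 ≤ ρ w.1 → N0 B v w = 0 := by
    intro v w hvw
    unfold N0
    rw [if_neg]
    intro h0
    exact absurd (hρ _ _ h0) (by omega)
  refine ⟨{ X := simp0 _, ε := fun _ => 1, hε := fun _ => Or.inl rfl, ρ := ρ,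
            ordH := fun v w hvw _ => simp0_hom _ hvw
            ordE := fun v w hvw => simp0_ext _ (hN v w hvw)
            e1 := fun v => by rw [simp0_E, hN v v le_rfl]; simp
            orth := fun v w _ hvw => simp0_hom _ hvw
            sgn := fun i j _ hj => by norm_num at hj
            rq := regQ0 B h
            β' := fun v => Finsupp.single v 1
            R := 1, S := 1
            reg := ?_
            mat := ?_ }⟩
  · have := reg_diag (n := n) (fun _ => 1)
    rw [Matrix.diagonal_one] at this
    simpa only [one_smul, simp0_dim] using this
  · rw [P0_sub B h]; simp

theorem main_list {N : Vx n → Vx n → ℕ} {P Qc : Mt n} (ks : List (Fin n)) :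
    ∀ B : Mt n, Nonempty (State N P Qc B) →
      Nonempty (State N P Qc (ks.foldl (fun M k => matMut k M) B)) := by
  induction ks with
  | nil => intro B h; exact h
  | cons k ks ih => intro B ⟨s⟩; exact ih _ (s.step k)

end SK


/-- Any acyclic sign-skew-symmetric integer matrix is totally sign-skew-symmetric. -/
theorem acyclic_sign_skew_symmetric_is_totally {n : ℕ} (hn : 0 < n)
    (B : Matrix (Fin n) (Fin n) ℤ) (hsss : SignSkewSymm B) (hac : MatAcyclic B) :
    ∀ ks : List (Fin n), SignSkewSymm (ks.foldl (fun M k => matMut k M) B) := by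
  intro ks
  obtain ⟨s⟩ := SK.main_list ks B (SK.state0 B hsss hac)
  exact s.sss
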